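/- arXiv:1511.03716 — 2 statements merged into one kernel-verified Lean document; each statement's English description precedes it below -/
import Mathlib

section
/- For every complex number q with |q| < 1, the square of the Borwein theta function a₀(q) = ∑_{m,n ∈ ℤ} q^{m²+mn+n²} satisfies a₀(q)² = 1 + 12 ∑_{n=1}^∞ n q^n/(1-q^n) - 36 ∑_{n=1}^∞ n q^{3n}/(1-q^{3n}). -/
/-- Borwein theta function `a₀(q) = ∑_{m,n ∈ ℤ} q^{m²+mn+n²}`. -/
noncomputable def a0 (q : ℂ) : ℂ :=
  ∑' p : ℤ × ℤ, q ^ (p.1 ^ 2 + p.1 * p.2 + p.2 ^ 2)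

/-- The nontrivial character mod 3. -/
def chi3 (n : ℕ) : ℤ := if n % 3 = 1 then 1 else if n % 3 = 2 then -1 else 0

/-- Divisor sum of the character. -/
def Lsum (n : ℕ) : ℤ := ∑ d ∈ n.divisors, chi3 d

/-- The set of representations of `n` by the form. -/
def repSet (n : ℕ) : Set (ℤ × ℤ) := {z | z.1 ^ 2 + z.1 * z.2 + z.2 ^ 2 = (n : ℤ)}

lemma chi3_mul (a b : ℕ) : chi3 (a * b) = chi3 a * chi3 b := by
  have ha := Nat.mod_lt a (show 0 < 3 by norm_num)
  have hb := Nat.mod_lt b (show 0 < 3 by norm_num)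
  unfold chi3
  rw [Nat.mul_mod]
  generalize a % 3 = x at *
  generalize b % 3 = y at *
  interval_cases x <;> interval_cases y <;> simp

lemma Lsum_mul_prime (p n : ℕ) (hp : p.Prime) (hn : n ≠ 0) :
    Lsum (p * n) = (1 + chi3 p) * Lsum n - chi3 p * (if p ∣ n then Lsum (n / p) else 0) := by
  -- multiples of `p` among the divisors of `p * m`
  have key : ∀ m : ℕ, m ≠ 0 →
      ∑ d ∈ (p * m).divisors with p ∣ d, chi3 d = chi3 p * Lsum m := by
    intro m hm
    unfold Lsum
    rw [Finset.mul_sum]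
    symm
    apply Finset.sum_bij (fun d _ => p * d)
    · intro d hd
      simp only [Nat.mem_divisors, Finset.mem_filter] at hd ⊢
      exact ⟨⟨Nat.mul_dvd_mul_left p hd.1, mul_ne_zero hp.ne_zero hm⟩, dvd_mul_right _ _⟩
    · intro a _ b _ h
      exact Nat.eq_of_mul_eq_mul_left hp.pos h
    · intro d hd
      simp only [Nat.mem_divisors, Finset.mem_filter] at hd
      obtain ⟨⟨h1, h2⟩, e, rfl⟩ := hd
      exact ⟨e, by simpa [hm] using Nat.dvd_of_mul_dvd_mul_left hp.pos h1, rfl⟩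
    · intro d _
      rw [chi3_mul]
  have h1 := Finset.sum_filter_add_sum_filter_not (p * n).divisors (fun d => p ∣ d) chi3
  have h2 := Finset.sum_filter_add_sum_filter_not n.divisors (fun d => p ∣ d) chi3
  have h3 : (p * n).divisors.filter (fun d => ¬ p ∣ d) = n.divisors.filter (fun d => ¬ p ∣ d) := by
    ext d
    simp only [Nat.mem_divisors, Finset.mem_filter]
    constructor
    · rintro ⟨⟨h, _⟩, hd⟩
      exact ⟨⟨((Nat.Prime.coprime_iff_not_dvd hp).2 hd).symm.dvd_of_dvd_mul_left h, hn⟩, hd⟩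
    · rintro ⟨⟨h, _⟩, hd⟩
      exact ⟨⟨h.mul_left p, mul_ne_zero hp.ne_zero hn⟩, hd⟩
  have h4 : ∑ d ∈ n.divisors with p ∣ d, chi3 d =
      chi3 p * (if p ∣ n then Lsum (n / p) else 0) := by
    split_ifs with h
    · obtain ⟨m, rfl⟩ := h
      rw [Nat.mul_div_cancel_left m hp.pos]
      exact key m (by rintro rfl; simp at hn)
    · rw [mul_zero]
      apply Finset.sum_eq_zero
      intro d hd
      simp only [Nat.mem_divisors, Finset.mem_filter] at hd
      exact absurd (hd.2.trans hd.1.1) h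
  rw [key n hn, h3] at h1
  rw [h4] at h2
  change _ = Lsum (p * n) at h1
  change _ = Lsum n at h2
  linarith

lemma repSet_finite (n : ℕ) : (repSet n).Finite := by
  apply Set.Finite.subset ((Set.finite_Icc (-(2 * n : ℤ)) (2 * n)).prod
    (Set.finite_Icc (-(2 * n : ℤ)) (2 * n)))
  rintro ⟨x, y⟩ h
  simp only [repSet, Set.mem_ofPred_eq] at h
  have hx : x ^ 2 ≤ 2 * n := by nlinarith [sq_nonneg (x + y), sq_nonneg y]
  have hy : y ^ 2 ≤ 2 * n := by nlinarith [sq_nonneg (x + y), sq_nonneg x]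
  have e1 : |x| ≤ x ^ 2 := by rw [← sq_abs]; nlinarith [Int.le_self_sq |x|]
  have e2 : |y| ≤ y ^ 2 := by rw [← sq_abs]; nlinarith [Int.le_self_sq |y|]
  have := abs_le.1 (e1.trans hx)
  have := abs_le.1 (e2.trans hy)
  simp only [Set.mem_prod, Set.mem_Icc]
  tauto

/-- Multiplication by the Eisenstein integer `a + b ω`, where `ω ^ 2 = ω - 1`. -/
def eMul (a b : ℤ) (z : ℤ × ℤ) : ℤ × ℤ := (a * z.1 - b * z.2, a * z.2 + b * z.1 + b * z.2)

lemma eMul_injective (a b : ℤ) (p : ℕ) (hp : p ≠ 0) (h : a ^ 2 + a * b + b ^ 2 = p) :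
    Function.Injective (eMul a b) := by
  have hp' : (p : ℤ) ≠ 0 := by exact_mod_cast hp
  rintro ⟨x, y⟩ ⟨x', y'⟩ h'
  simp only [eMul, Prod.mk.injEq] at h' ⊢
  obtain ⟨h1, h2⟩ := h'
  constructor
  · apply mul_left_cancel₀ hp'
    rw [← h]
    linear_combination (a + b) * h1 + b * h2
  · apply mul_left_cancel₀ hp'
    rw [← h]
    linear_combination a * h2 - b * h1

lemma eMul_mem (a b : ℤ) (p n : ℕ) (h : a ^ 2 + a * b + b ^ 2 = p) (z : ℤ × ℤ)
    (hz : z ∈ repSet n) : eMul a b z ∈ repSet (p * n) := by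
  obtain ⟨x, y⟩ := z
  simp only [repSet, eMul, Set.mem_ofPred_eq] at hz ⊢
  push_cast
  rw [← h, ← hz]
  ring

lemma eMul_mem_iff (a b : ℤ) (p n : ℕ) (hp : p ≠ 0)
    (h : a ^ 2 + a * b + b ^ 2 = p) (z : ℤ × ℤ) :
    eMul a b z ∈ repSet (p * n) ↔ z ∈ repSet n := by
  refine ⟨fun hz => ?_, eMul_mem a b p n h z⟩
  have hp' : (p : ℤ) ≠ 0 := by exact_mod_cast hp
  obtain ⟨x, y⟩ := z
  simp only [repSet, eMul, Set.mem_ofPred_eq] at hz ⊢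
  push_cast at hz
  apply mul_left_cancel₀ hp'
  rw [← hz, ← h]
  ring

lemma exists_eMul (a b : ℤ) (p : ℕ) (hp : p.Prime) (h : a ^ 2 + a * b + b ^ 2 = p) (x y : ℤ)
    (hz : (p : ℤ) ∣ x ^ 2 + x * y + y ^ 2) (hd : (p : ℤ) ∣ y * a - x * b) :
    ∃ w, eMul a b w = (x, y) := by
  have hpi : Prime (p : ℤ) := Nat.prime_iff_prime_int.1 hp
  have hre : (p : ℤ) ∣ x * a + x * b + y * b := by
    apply hpi.dvd_of_dvd_pow (n := 2)
    have : (x * a + x * b + y * b) ^ 2 = p * (x ^ 2 + x * y + y ^ 2)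
      - (y * a - x * b) * (x * a + x * b + y * b + (y * a - x * b)) := by
      rw [← h]; ring
    rw [this]
    exact dvd_sub (dvd_mul_right _ _) (hd.mul_right _)
  obtain ⟨u, hu⟩ := hre
  obtain ⟨v, hv⟩ := hd
  have hp' : (p : ℤ) ≠ 0 := hpi.ne_zero
  refine ⟨(u, v), ?_⟩
  simp only [eMul, Prod.mk.injEq]
  constructor
  · apply mul_left_cancel₀ hp'
    linear_combination -a * hu + b * hv + x * h
  · apply mul_left_cancel₀ hp'
    linear_combination -a * hv - b * hu - b * hv + y * h

lemma dvd_or_of_norm (a b : ℤ) (p : ℕ) (hp : p.Prime) (h : a ^ 2 + a * b + b ^ 2 = p) (x y : ℤ)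
    (hz : (p : ℤ) ∣ x ^ 2 + x * y + y ^ 2) :
    (p : ℤ) ∣ y * a - x * b ∨ (p : ℤ) ∣ y * (a + b) - x * (-b) := by
  have hpi : Prime (p : ℤ) := Nat.prime_iff_prime_int.1 hp
  apply hpi.dvd_or_dvd
  have : (y * a - x * b) * (y * (a + b) - x * (-b)) =
    p * y ^ 2 - b ^ 2 * (x ^ 2 + x * y + y ^ 2) := by rw [← h]; ring
  rw [this]
  exact dvd_sub (dvd_mul_right _ _) (hz.mul_left _)

lemma repSet_three (n : ℕ) : (repSet (3 * n)).ncard = (repSet n).ncard := by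
  have h : (1 : ℤ) ^ 2 + 1 * 1 + 1 ^ 2 = (3 : ℕ) := by norm_num
  rw [← Set.ncard_image_of_injective (repSet n) (eMul_injective 1 1 3 (by norm_num) h)]
  congr 1
  ext ⟨x, y⟩
  constructor
  · intro hz
    have hz' := hz
    simp only [repSet, Set.mem_ofPred_eq] at hz'
    have hd : ((3 : ℕ) : ℤ) ∣ x ^ 2 + x * y + y ^ 2 := by rw [hz']; simp
    have hd' : ((3 : ℕ) : ℤ) ∣ y * 1 - x * 1 := by
      rcases dvd_or_of_norm 1 1 3 Nat.prime_three h x y hd with h | h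
      · exact h
      · push_cast at h ⊢; omega
    obtain ⟨w, hw⟩ := exists_eMul 1 1 3 Nat.prime_three h x y hd hd'
    refine ⟨w, ?_, hw⟩
    rw [← hw] at hz
    exact (eMul_mem_iff 1 1 3 n (by norm_num) h w).1 hz
  · rintro ⟨w, hw, hw'⟩
    rw [← hw']
    exact eMul_mem 1 1 3 n h w hw

lemma root_unity_of_not_dvd (p : ℕ) (hp : p.Prime) (h3 : p ≠ 3) (x y : ℤ)
    (hz : (p : ℤ) ∣ x ^ 2 + x * y + y ^ 2) (hy : ¬ (p : ℤ) ∣ y) : p % 3 = 1 := by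
  have := Fact.mk hp
  have e : (x : ZMod p) ^ 2 + x * y + y ^ 2 = 0 := by
    have := (ZMod.intCast_zmod_eq_zero_iff_dvd _ p).2 hz
    push_cast at this
    exact this
  have hy' : (y : ZMod p) ≠ 0 := by
    rwa [Ne, ZMod.intCast_zmod_eq_zero_iff_dvd]
  set t : ZMod p := x / y with ht
  have ht1 : t ^ 2 + t + 1 = 0 := by
    rw [ht]; field_simp; linear_combination e
  have ht3 : t ^ 3 = 1 := by linear_combination (t - 1) * ht1
  have htn : t ≠ 1 := by
    intro h1
    rw [h1] at ht1
    have h30 : ((3 : ℕ) : ZMod p) = 0 := by push_cast; linear_combination ht1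
    rw [ZMod.natCast_eq_zero_iff] at h30
    exact h3 ((Nat.prime_dvd_prime_iff_eq hp Nat.prime_three).1 h30)
  have ho : orderOf t = 3 := orderOf_eq_prime ht3 htn
  have ht0 : t ≠ 0 := by rintro h0; rw [h0] at ht3; norm_num at ht3
  have hd : 3 ∣ p - 1 := by rw [← ho]; exact ZMod.orderOf_dvd_card_sub_one ht0
  have := hp.two_le
  omega

lemma dvd_both_of_two (p : ℕ) (hp : p.Prime) (h2 : p % 3 = 2) (x y : ℤ)
    (hz : (p : ℤ) ∣ x ^ 2 + x * y + y ^ 2) : (p : ℤ) ∣ x ∧ (p : ℤ) ∣ y := by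
  have h3 : p ≠ 3 := by rintro rfl; simp at h2
  constructor
  · by_contra hx
    have := root_unity_of_not_dvd p hp h3 y x (by convert hz using 1; ring) hx
    omega
  · by_contra hy
    have := root_unity_of_not_dvd p hp h3 x y hz hy
    omega

lemma scale_injective (p : ℕ) (hp : p ≠ 0) :
    Function.Injective (fun z : ℤ × ℤ => ((p : ℤ) * z.1, (p : ℤ) * z.2)) := by
  have hp' : (p : ℤ) ≠ 0 := by exact_mod_cast hp
  rintro ⟨x, y⟩ ⟨x', y'⟩ h
  simpa [hp] using h

/-- Representations of `p * n` divisible by `p`. -/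
lemma ncard_scaled (p n : ℕ) (hp : p.Prime) :
    ({z : ℤ × ℤ | z ∈ repSet (p * n) ∧ (p : ℤ) ∣ z.1 ∧ (p : ℤ) ∣ z.2}).ncard =
      if p ∣ n then (repSet (n / p)).ncard else 0 := by
  have hp' : (p : ℤ) ≠ 0 := by exact_mod_cast hp.ne_zero
  split_ifs with h
  · obtain ⟨m, rfl⟩ := h
    rw [Nat.mul_div_cancel_left m hp.pos,
      ← Set.ncard_image_of_injective (repSet m) (scale_injective p hp.ne_zero)]
    congr 1
    ext ⟨x, y⟩
    simp only [repSet, Set.mem_ofPred_eq, Set.mem_image, Prod.mk.injEq, Prod.exists]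
    constructor
    · rintro ⟨h1, ⟨u, rfl⟩, ⟨v, rfl⟩⟩
      refine ⟨u, v, ?_, rfl, rfl⟩
      apply mul_left_cancel₀ hp'
      apply mul_left_cancel₀ hp'
      push_cast at h1
      linear_combination h1
    · rintro ⟨u, v, h1, rfl, rfl⟩
      refine ⟨?_, dvd_mul_right _ _, dvd_mul_right _ _⟩
      push_cast
      linear_combination (p : ℤ) ^ 2 * h1
  · rw [Set.ncard_eq_zero ((repSet_finite (p * n)).subset (fun z hz => hz.1))]
    ext ⟨x, y⟩
    simp only [repSet, Set.mem_ofPred_eq, Set.mem_empty_iff_false, iff_false]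
    rintro ⟨h1, ⟨u, rfl⟩, ⟨v, rfl⟩⟩
    apply h
    have : (p : ℤ) ∣ n := by
      refine ⟨u ^ 2 + u * v + v ^ 2, ?_⟩
      apply mul_left_cancel₀ hp'
      push_cast at h1
      linear_combination -h1
    exact_mod_cast this

lemma repSet_two (p n : ℕ) (hp : p.Prime) (h2 : p % 3 = 2) :
    (repSet (p * n)).ncard = if p ∣ n then (repSet (n / p)).ncard else 0 := by
  rw [← ncard_scaled p n hp]
  congr 1
  ext ⟨x, y⟩
  simp only [Set.mem_ofPred_eq]
  refine ⟨fun h => ⟨h, ?_⟩, fun h => h.1⟩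
  apply dvd_both_of_two p hp h2
  simp only [repSet, Set.mem_ofPred_eq] at h
  rw [h]; simp

lemma exists_root (p : ℕ) (hp : p.Prime) (h1 : p % 3 = 1) : ∃ t : ZMod p, t ^ 2 + t + 1 = 0 := by
  have := Fact.mk hp
  have := Fact.mk Nat.prime_three
  have hc : 3 ∣ Fintype.card (ZMod p)ˣ := by
    rw [ZMod.card_units]; omega
  obtain ⟨g, hg⟩ := exists_prime_orderOf_dvd_card 3 hc
  refine ⟨(g : ZMod p), ?_⟩
  have h3 : (g : ZMod p) ^ 3 = 1 := by
    have := pow_orderOf_eq_one g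
    rw [hg] at this
    rw [← Units.val_pow_eq_pow_val, this, Units.val_one]
  have hne : (g : ZMod p) - 1 ≠ 0 := by
    intro h
    have : g = 1 := Units.ext (by simpa using sub_eq_zero.1 h)
    rw [this, orderOf_one] at hg
    norm_num at hg
  apply mul_left_cancel₀ hne
  linear_combination h3

lemma exists_eisenstein_norm (p : ℕ) (hp : p.Prime) (h1 : p % 3 = 1) :
    ∃ a b : ℤ, a ^ 2 + a * b + b ^ 2 = p := by
  have := Fact.mk hp
  obtain ⟨t, ht⟩ := exists_root p hp h1
  set s := Nat.sqrt p with hs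
  -- pigeonhole (Thue)
  let S := Finset.range (s + 1) ×ˢ Finset.range (s + 1)
  have hcard : (Finset.univ : Finset (ZMod p)).card < S.card := by
    rw [Finset.card_univ, ZMod.card, Finset.card_product, Finset.card_range]
    exact Nat.lt_succ_sqrt p
  obtain ⟨⟨x, y⟩, hx, ⟨x', y'⟩, hx', hne, hf⟩ :=
    Finset.exists_ne_map_eq_of_card_lt_of_maps_to hcard
      (f := fun z : ℕ × ℕ => (z.1 : ZMod p) - t * z.2) (fun _ _ => Finset.mem_univ _)
  simp only [S, Finset.mem_product, Finset.mem_range] at hx hx'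
  simp only at hf
  obtain ⟨a, ha⟩ : ∃ a : ℤ, a = x - x' := ⟨_, rfl⟩
  obtain ⟨b, hb⟩ : ∃ b : ℤ, b = y - y' := ⟨_, rfl⟩
  have hab : (a : ZMod p) = t * b := by
    rw [ha, hb]; push_cast; linear_combination hf
  have hdvd : (p : ℤ) ∣ a ^ 2 + a * b + b ^ 2 := by
    rw [← ZMod.intCast_zmod_eq_zero_iff_dvd]
    push_cast
    rw [hab]
    linear_combination (b : ZMod p) ^ 2 * ht
  have hsq : (s : ℤ) * s < p := by
    have h1 : s * s ≤ p := Nat.sqrt_le p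
    have h2 : s * s ≠ p := by
      intro h
      have := hp.prime.irreducible.not_isSquare
      exact this ⟨s, h.symm⟩
    exact_mod_cast lt_of_le_of_ne h1 h2
  have ha1 : |a| ≤ s := by rw [abs_le]; omega
  have hb1 : |b| ≤ s := by rw [abs_le]; omega
  have ha2 : a ^ 2 < p := by rw [← sq_abs]; nlinarith [abs_nonneg a]
  have hb2 : b ^ 2 < p := by rw [← sq_abs]; nlinarith [abs_nonneg b]
  have hne0 : a ≠ 0 ∨ b ≠ 0 := by
    by_contra! h
    apply hne
    rw [Prod.mk.injEq]
    omega
  have hpos : 0 < a ^ 2 + a * b + b ^ 2 := by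
    rcases hne0 with h | h
    · nlinarith [sq_nonneg (a + 2 * b), sq_pos_of_ne_zero h]
    · nlinarith [sq_nonneg (2 * a + b), sq_pos_of_ne_zero h]
  have hlt : a ^ 2 + a * b + b ^ 2 < 3 * p := by nlinarith [sq_nonneg (a - b)]
  obtain ⟨k, hk⟩ := hdvd
  have hp0 : (0 : ℤ) < p := by exact_mod_cast hp.pos
  have hk1 : 0 < k := by
    rw [hk] at hpos
    exact pos_of_mul_pos_right hpos hp0.le
  have hk3 : k < 3 := by
    rw [hk] at hlt
    nlinarith
  interval_cases k
  · exact ⟨a, b, by linarith⟩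
  · exfalso
    have h2 := dvd_both_of_two 2 Nat.prime_two rfl a b (by rw [hk]; simp)
    obtain ⟨⟨u, rfl⟩, ⟨v, rfl⟩⟩ := h2
    have h4 : (p : ℤ) = 2 * (u ^ 2 + u * v + v ^ 2) := by
      push_cast at hk
      linarith
    have h5 : (2 : ℕ) ∣ p := by
      have : (2 : ℤ) ∣ p := ⟨_, h4⟩
      exact_mod_cast this
    have := (Nat.prime_dvd_prime_iff_eq Nat.prime_two hp).1 h5
    omega

lemma repSet_one_mod (p n : ℕ) (hp : p.Prime) (h1 : p % 3 = 1) :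
    (repSet (p * n)).ncard + (if p ∣ n then (repSet (n / p)).ncard else 0)
      = 2 * (repSet n).ncard := by
  obtain ⟨a, b, h⟩ := exists_eisenstein_norm p hp h1
  have hpi : Prime (p : ℤ) := Nat.prime_iff_prime_int.1 hp
  have hc : (a + b) ^ 2 + (a + b) * (-b) + (-b) ^ 2 = p := by rw [← h]; ring
  have hi1 := eMul_injective a b p hp.ne_zero h
  have hi2 := eMul_injective (a + b) (-b) p hp.ne_zero hc
  have hU : repSet (p * n) = eMul a b '' repSet n ∪ eMul (a + b) (-b) '' repSet n := by
    ext ⟨x, y⟩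
    constructor
    · intro hz
      have hz' := hz
      simp only [repSet, Set.mem_ofPred_eq] at hz'
      have hd : (p : ℤ) ∣ x ^ 2 + x * y + y ^ 2 := by rw [hz']; simp
      rcases dvd_or_of_norm a b p hp h x y hd with hh | hh
      · left
        obtain ⟨w, hw⟩ := exists_eMul a b p hp h x y hd hh
        rw [← hw] at hz
        exact ⟨w, (eMul_mem_iff a b p n hp.ne_zero h w).1 hz, hw⟩
      · right
        obtain ⟨w, hw⟩ := exists_eMul (a + b) (-b) p hp hc x y hd hh
        rw [← hw] at hz
        exact ⟨w, (eMul_mem_iff (a + b) (-b) p n hp.ne_zero hc w).1 hz, hw⟩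
    · rintro (⟨w, hw, hw'⟩ | ⟨w, hw, hw'⟩)
      · rw [← hw']; exact eMul_mem a b p n h w hw
      · rw [← hw']; exact eMul_mem (a + b) (-b) p n hc w hw
  have hI : eMul a b '' repSet n ∩ eMul (a + b) (-b) '' repSet n =
      {z : ℤ × ℤ | z ∈ repSet (p * n) ∧ (p : ℤ) ∣ z.1 ∧ (p : ℤ) ∣ z.2} := by
    have hb0 : ¬ (p : ℤ) ∣ b := by
      intro hb
      have ha : (p : ℤ) ∣ a := by
        apply hpi.dvd_of_dvd_pow (n := 2)
        have : a ^ 2 = p - b * (a + b) := by rw [← h]; ring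
        rw [this]
        exact dvd_sub dvd_rfl (hb.mul_right _)
      obtain ⟨u, rfl⟩ := ha
      obtain ⟨v, rfl⟩ := hb
      have : (p : ℤ) * (u ^ 2 + u * v + v ^ 2) = 1 := by
        apply mul_left_cancel₀ hpi.ne_zero
        linear_combination h
      exact hpi.not_isUnit (IsUnit.of_mul_eq_one _ this)
    have hab0 : ¬ (p : ℤ) ∣ 2 * a + b := by
      intro hd
      have h3 : (p : ℤ) ∣ 3 * b ^ 2 := by
        have : 3 * b ^ 2 = 4 * p - (2 * a + b) * (2 * a + b) := by rw [← h]; ring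
        rw [this]
        exact dvd_sub (dvd_mul_left _ _) (hd.mul_right _)
      rcases hpi.dvd_or_dvd h3 with h3 | h3
      · have h3' : p ∣ 3 := by exact_mod_cast h3
        have := (Nat.prime_dvd_prime_iff_eq hp Nat.prime_three).1 h3'
        omega
      · exact hb0 (hpi.dvd_of_dvd_pow h3)
    ext ⟨x, y⟩
    constructor
    · rintro ⟨⟨⟨u, v⟩, hw, hw'⟩, ⟨⟨u', v'⟩, hv, hv'⟩⟩
      refine ⟨by rw [hU]; exact Or.inl ⟨_, hw, hw'⟩, ?_⟩
      simp only [eMul, Prod.mk.injEq] at hw' hv' ⊢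
      have e1 : (p : ℤ) ∣ y * a - x * b := by
        refine ⟨v, ?_⟩
        rw [← hw'.1, ← hw'.2, ← h]; ring
      have e2 : (p : ℤ) ∣ y * (a + b) + x * b := by
        refine ⟨v', ?_⟩
        rw [← hv'.1, ← hv'.2, ← h]; ring
      have hy : (p : ℤ) ∣ y := by
        have : (p : ℤ) ∣ y * (2 * a + b) := by
          have e3 := dvd_add e1 e2
          rwa [show y * a - x * b + (y * (a + b) + x * b) = y * (2 * a + b) by ring] at e3
        exact (hpi.dvd_or_dvd this).resolve_right hab0
      refine ⟨?_, hy⟩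
      have : (p : ℤ) ∣ x * b := by
        have e3 := dvd_sub (hy.mul_right a) e1
        rwa [show y * a - (y * a - x * b) = x * b by ring] at e3
      exact (hpi.dvd_or_dvd this).resolve_right hb0
    · rintro ⟨hz, hx, hy⟩
      have hz' := hz
      simp only [repSet, Set.mem_ofPred_eq] at hz' hx hy
      have hd : (p : ℤ) ∣ x ^ 2 + x * y + y ^ 2 := by rw [hz']; simp
      constructor
      · obtain ⟨w, hw⟩ := exists_eMul a b p hp h x y hd
          (dvd_sub (hy.mul_right _) (hx.mul_right _))
        rw [← hw] at hz
        exact ⟨w, (eMul_mem_iff a b p n hp.ne_zero h w).1 hz, hw⟩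
      · obtain ⟨w, hw⟩ := exists_eMul (a + b) (-b) p hp hc x y hd
          (dvd_sub (hy.mul_right _) (hx.mul_right _))
        rw [← hw] at hz
        exact ⟨w, (eMul_mem_iff (a + b) (-b) p n hp.ne_zero hc w).1 hz, hw⟩
  have := Set.ncard_union_add_ncard_inter (eMul a b '' repSet n) (eMul (a + b) (-b) '' repSet n)
    ((repSet_finite n).image _) ((repSet_finite n).image _)
  rw [← hU, hI, ncard_scaled p n hp, Set.ncard_image_of_injective _ hi1,
    Set.ncard_image_of_injective _ hi2] at this
  omega

lemma repSet_one : (repSet 1).ncard = 6 := by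
  have : repSet 1 = ↑({(1, 0), (-1, 0), (0, 1), (0, -1), (1, -1), (-1, 1)} : Finset (ℤ × ℤ)) := by
    ext ⟨x, y⟩
    simp only [repSet, Set.mem_ofPred_eq]
    constructor
    · intro h
      push_cast at h
      have hx : x ^ 2 ≤ 1 := by nlinarith [sq_nonneg (x + 2 * y)]
      have hy : y ^ 2 ≤ 1 := by nlinarith [sq_nonneg (2 * x + y)]
      obtain ⟨h1, h2⟩ := abs_le.1 ((sq_le_one_iff_abs_le_one x).1 hx)
      obtain ⟨h3, h4⟩ := abs_le.1 ((sq_le_one_iff_abs_le_one y).1 hy)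
      interval_cases x <;> interval_cases y <;> simp_all
    · intro h
      simp only [Finset.coe_insert, Finset.coe_singleton, Set.mem_insert_iff, Prod.mk.injEq,
        Set.mem_singleton_iff] at h
      rcases h with h | h | h | h | h | h <;> obtain ⟨rfl, rfl⟩ := h <;> norm_num
  rw [this, Set.ncard_coe_finset]
  rfl

lemma repSet_zero : (repSet 0).ncard = 1 := by
  rw [Set.ncard_eq_one]
  refine ⟨(0, 0), ?_⟩
  ext ⟨x, y⟩
  simp only [repSet, Set.mem_ofPred_eq, Set.mem_singleton_iff, Prod.mk.injEq]
  constructor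
  · intro h
    push_cast at h
    have hx : x ^ 2 = 0 := by nlinarith [sq_nonneg (x + 2 * y), sq_nonneg x]
    have hy : y ^ 2 = 0 := by nlinarith [sq_nonneg (2 * x + y), sq_nonneg y]
    exact ⟨pow_eq_zero_iff (by norm_num) |>.1 hx, pow_eq_zero_iff (by norm_num) |>.1 hy⟩
  · rintro ⟨rfl, rfl⟩
    norm_num

theorem repSet_ncard (n : ℕ) (hn : n ≠ 0) : ((repSet n).ncard : ℤ) = 6 * Lsum n := by
  induction n using Nat.strong_induction_on with
  | _ n ih =>
    by_cases h1 : n = 1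
    · subst h1
      rw [repSet_one]
      simp [Lsum, chi3]
    obtain ⟨p, hp, m, rfl⟩ := Nat.exists_prime_and_dvd h1
    have hm : m ≠ 0 := by rintro rfl; simp at hn
    have hlt : m < p * m := by
      have := hp.two_le
      have := Nat.pos_of_ne_zero hm
      nlinarith
    have hi := ih m hlt hm
    have hi2 : ((if p ∣ m then (repSet (m / p)).ncard else 0 : ℕ) : ℤ) =
        6 * (if p ∣ m then Lsum (m / p) else 0) := by
      split_ifs with h
      · apply ih (m / p) ((Nat.div_le_self m p).trans_lt hlt)
        exact (Nat.div_pos (Nat.le_of_dvd (Nat.pos_of_ne_zero hm) h) hp.pos).ne'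
      · simp
    rw [Lsum_mul_prime p m hp hm]
    have h3 : p % 3 = 0 ∨ p % 3 = 1 ∨ p % 3 = 2 := by omega
    rcases h3 with h | h | h
    · have : p = 3 :=
        ((Nat.prime_dvd_prime_iff_eq Nat.prime_three hp).1 (Nat.dvd_of_mod_eq_zero h)).symm
      subst this
      rw [repSet_three, hi]
      simp [chi3]
    · have hr := repSet_one_mod p m hp h
      have hx : chi3 p = 1 := by simp [chi3, h]
      rw [hx]
      have hr' := congrArg (fun k : ℕ => (k : ℤ)) hr
      simp only [Nat.cast_add, Nat.cast_mul] at hr'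
      rw [hi2, hi] at hr'
      push_cast at hr'
      linarith
    · have hx : chi3 p = -1 := by simp [chi3, h]
      rw [hx, repSet_two p m hp h, hi2]
      ring

section analysis

lemma hasSum_of_eq {ι : Type*} {f g : ι → ℂ} {a : ℂ} (h : HasSum f a) (hfg : ∀ x, g x = f x) :
    HasSum g a := by
  rw [show g = f from funext hfg]
  exact h

lemma hasSum_antidiagonal_of {f : ℕ × ℕ → ℂ} {a : ℂ} (h : HasSum f a) :
    HasSum (fun n => ∑ p ∈ Finset.HasAntidiagonal.antidiagonal n, f p) a := by
  have h1 := (Finset.HasAntidiagonal.sigmaAntidiagonalEquivProd (A := ℕ)).hasSum_iff.2 h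
  refine h1.sigma (fun n => ?_)
  exact Finset.hasSum (Finset.HasAntidiagonal.antidiagonal n) f

lemma hasSum_split {f : ℕ × ℕ → ℂ} {a : ℂ} (h : HasSum f a) :
    ∃ s0 s1 s2, HasSum (fun n => f (n, n)) s0 ∧
      HasSum (fun p : ℕ × ℕ => f (p.1, p.1 + p.2 + 1)) s1 ∧
      HasSum (fun p : ℕ × ℕ => f (p.1 + p.2 + 1, p.1)) s2 ∧ a = s0 + (s1 + s2) := by
  let i0 : ℕ → ℕ × ℕ := fun n => (n, n)
  let i1 : ℕ × ℕ → ℕ × ℕ := fun p => (p.1, p.1 + p.2 + 1)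
  let i2 : ℕ × ℕ → ℕ × ℕ := fun p => (p.1 + p.2 + 1, p.1)
  have j0 : Function.Injective i0 := by
    intro m n h
    simpa [i0] using h
  have j1 : Function.Injective i1 := by
    rintro ⟨m, n⟩ ⟨m', n'⟩ h
    simp only [i1, Prod.mk.injEq] at h ⊢
    omega
  have j2 : Function.Injective i2 := by
    rintro ⟨m, n⟩ ⟨m', n'⟩ h
    simp only [i2, Prod.mk.injEq] at h ⊢
    omega
  have k0 := (h.summable.comp_injective j0).hasSum
  have k1 := (h.summable.comp_injective j1).hasSum
  have k2 := (h.summable.comp_injective j2).hasSum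
  refine ⟨_, _, _, k0, k1, k2, ?_⟩
  have l0 := j0.hasSum_range_iff.2 k0
  have l1 := j1.hasSum_range_iff.2 k1
  have l2 := j2.hasSum_range_iff.2 k2
  have d12 : Disjoint (Set.range i1) (Set.range i2) := by
    rw [Set.disjoint_left]
    rintro _ ⟨⟨m, n⟩, rfl⟩ ⟨⟨m', n'⟩, h⟩
    simp only [i1, i2, Prod.mk.injEq] at h
    omega
  have d0 : Disjoint (Set.range i0) (Set.range i1 ∪ Set.range i2) := by
    rw [Set.disjoint_left]
    rintro _ ⟨m, rfl⟩ (⟨⟨m', n'⟩, h⟩ | ⟨⟨m', n'⟩, h⟩)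
    · simp only [i1, i0, Prod.mk.injEq] at h
      omega
    · simp only [i2, i0, Prod.mk.injEq] at h
      omega
  have l := HasSum.add_disjoint (f := f) d0 l0 (HasSum.add_disjoint (f := f) d12 l1 l2)
  have hu : Set.range i0 ∪ (Set.range i1 ∪ Set.range i2) = Set.univ := by
    rw [Set.eq_univ_iff_forall]
    rintro ⟨m, n⟩
    rcases lt_trichotomy m n with hh | hh | hh
    · right; left
      exact ⟨(m, n - m - 1), by simp only [i1, Prod.mk.injEq, true_and]; omega⟩
    · left
      exact ⟨m, by simp [i0, hh]⟩
    · right; right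
      exact ⟨(n, m - n - 1), by simp only [i2, Prod.mk.injEq, and_true]; omega⟩
  rw [hu] at l
  have l' := (hasSum_subtype_iff_indicator (f := f)).1 l
  rw [Set.indicator_univ] at l'
  exact h.unique l'

/-- `cos (2 π n / 3)`. -/
noncomputable def cc (n : ℕ) : ℂ := if n % 3 = 0 then 1 else -1 / 2

lemma norm_cc_le (n : ℕ) : ‖cc n‖ ≤ 1 := by
  unfold cc; split_ifs <;> norm_num

lemma norm_chi3_le (n : ℕ) : ‖(chi3 n : ℂ)‖ ≤ 1 := by
  unfold chi3; split_ifs <;> norm_num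

lemma cc_sum (n : ℕ) : ∑ k ∈ Finset.range n, cc (k + 1) =
    if n % 3 = 0 then 0 else if n % 3 = 1 then -1 / 2 else -1 := by
  induction n with
  | zero => simp
  | succ n ih =>
    rw [Finset.sum_range_succ, ih]
    unfold cc
    have h3 : n % 3 = 0 ∨ n % 3 = 1 ∨ n % 3 = 2 := by omega
    rcases h3 with h | h | h <;> simp [Nat.add_mod, h] <;> norm_num

lemma chi_cc (m k : ℕ) : 3 * ((chi3 m : ℂ) * chi3 (m + k)) = 2 * (cc k - cc (2 * m + k)) := by
  unfold chi3 cc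
  have h3 : m % 3 = 0 ∨ m % 3 = 1 ∨ m % 3 = 2 := by omega
  have h4 : k % 3 = 0 ∨ k % 3 = 1 ∨ k % 3 = 2 := by omega
  rcases h3 with h | h | h <;> rcases h4 with h' | h' | h' <;>
    simp [Nat.add_mod, Nat.mul_mod, h, h'] <;> norm_num

lemma one_sub_ne (q : ℂ) (hq : ‖q‖ < 1) (n : ℕ) : 1 - q ^ (n + 1) ≠ 0 := by
  intro h
  have h1 : q ^ (n + 1) = 1 := (sub_eq_zero.1 h).symm
  have h2 : ‖q‖ ^ (n + 1) = 1 := by rw [← norm_pow, h1, norm_one]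
  have := pow_lt_one₀ (norm_nonneg q) hq (Nat.succ_ne_zero n)
  rw [Nat.succ_eq_add_one] at this
  linarith

/-- The Lambert coefficient. -/
noncomputable def vv (q : ℂ) (n : ℕ) : ℂ := q ^ (n + 1) / (1 - q ^ (n + 1))

lemma vv_rel (q : ℂ) (hq : ‖q‖ < 1) (m k : ℕ) :
    vv q m * vv q k = vv q (m + k + 1) * (1 + vv q m + vv q k) := by
  unfold vv
  have h1 := one_sub_ne q hq m
  have h2 := one_sub_ne q hq k
  have h3 := one_sub_ne q hq (m + k + 1)
  field_simp
  ring

lemma norm_vv_le (q : ℂ) (hq : ‖q‖ < 1) (n : ℕ) :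
    ‖vv q n‖ ≤ (1 - ‖q‖)⁻¹ * ‖q‖ ^ n := by
  unfold vv
  have h0 : 0 < 1 - ‖q‖ := by linarith
  have hle : ‖q‖ ^ (n + 1) ≤ ‖q‖ := by
    simpa using pow_le_pow_of_le_one (norm_nonneg q) hq.le (Nat.succ_le_succ (Nat.zero_le n))
  have h1 : 1 - ‖q‖ ≤ ‖1 - q ^ (n + 1)‖ := by
    have := norm_sub_norm_le (1 : ℂ) (q ^ (n + 1))
    rw [norm_one, norm_pow] at this
    linarith
  rw [norm_div, norm_pow, inv_mul_eq_div]
  apply div_le_div₀ (by positivity) _ h0 h1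
  exact pow_le_pow_of_le_one (norm_nonneg q) hq.le (Nat.le_succ n)

lemma summable_of_geo2 (r K : ℝ) (hr0 : 0 ≤ r) (hr : r < 1) (f : ℕ × ℕ → ℂ)
    (hf : ∀ p, ‖f p‖ ≤ K * (r ^ p.1 * r ^ p.2)) : Summable f := by
  have hg := summable_geometric_of_lt_one hr0 hr
  have := (hg.mul_of_nonneg hg (fun n => pow_nonneg hr0 n) (fun n => pow_nonneg hr0 n)).mul_left K
  exact Summable.of_norm_bounded this hf

lemma summable_vv (q : ℂ) (hq : ‖q‖ < 1) (e : ℕ → ℂ) (he : ∀ n, ‖e n‖ ≤ 1) :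
    Summable (fun n => e n * vv q n) := by
  have hg := (summable_geometric_of_lt_one (norm_nonneg q) hq).mul_left (1 - ‖q‖)⁻¹
  refine Summable.of_norm_bounded hg (fun n => ?_)
  rw [norm_mul]
  calc _ ≤ 1 * ‖vv q n‖ := by gcongr; exact he n
    _ ≤ _ := by rw [one_mul]; exact norm_vv_le q hq n

lemma summable_vv2 (q : ℂ) (hq : ‖q‖ < 1) (e : ℕ × ℕ → ℂ) (he : ∀ n, ‖e n‖ ≤ 1) :
    Summable (fun p : ℕ × ℕ => e p * (vv q p.1 * vv q p.2)) := by
  have h0 : 0 < 1 - ‖q‖ := by linarith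
  apply summable_of_geo2 ‖q‖ ((1 - ‖q‖)⁻¹ * (1 - ‖q‖)⁻¹) (norm_nonneg q) hq
  intro p
  rw [norm_mul, norm_mul]
  calc _ ≤ 1 * (((1 - ‖q‖)⁻¹ * ‖q‖ ^ p.1) * ((1 - ‖q‖)⁻¹ * ‖q‖ ^ p.2)) := by
        gcongr
        · exact he p
        · exact norm_vv_le q hq _
        · exact norm_vv_le q hq _
    _ = _ := by ring

lemma summable_vv3 (q : ℂ) (hq : ‖q‖ < 1) (e : ℕ × ℕ → ℂ) (he : ∀ n, ‖e n‖ ≤ 1) :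
    Summable (fun p : ℕ × ℕ => e p * vv q (p.1 + p.2 + 1)) := by
  have h0 : 0 < 1 - ‖q‖ := by linarith
  apply summable_of_geo2 ‖q‖ ((1 - ‖q‖)⁻¹) (norm_nonneg q) hq
  intro p
  rw [norm_mul]
  calc _ ≤ 1 * ((1 - ‖q‖)⁻¹ * ‖q‖ ^ (p.1 + p.2 + 1)) := by
        gcongr
        · exact he p
        · exact norm_vv_le q hq _
    _ ≤ 1 * ((1 - ‖q‖)⁻¹ * ‖q‖ ^ (p.1 + p.2)) := by
        gcongr 1 * ((1 - ‖q‖)⁻¹ * ?_)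
        exact pow_le_pow_of_le_one (norm_nonneg q) hq.le (Nat.le_succ _)
    _ = _ := by rw [pow_add]; ring

/-- Key quadratic identity. -/
lemma key_hasSum (q : ℂ) (hq : ‖q‖ < 1) :
    HasSum (fun n : ℕ => ((n : ℂ) + 1) * vv q n +
      if (n + 1) % 3 = 0 then 6 * (vv q n ^ 2 + vv q n) - 3 * (((n : ℂ) + 1) * vv q n) else 0)
      ((∑' n : ℕ, (chi3 (n + 1) : ℂ) * vv q n) +
        3 * (∑' n : ℕ, (chi3 (n + 1) : ℂ) * vv q n) ^ 2) := by
  set X := ∑' n : ℕ, (chi3 (n + 1) : ℂ) * vv q n with hX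
  set v := vv q with hv
  have hsx : Summable (fun n : ℕ => (chi3 (n + 1) : ℂ) * v n) :=
    summable_vv q hq _ (fun n => norm_chi3_le _)
  -- the square
  have hXX : HasSum (fun p : ℕ × ℕ => ((chi3 (p.1 + 1) : ℂ) * chi3 (p.2 + 1)) * (v p.1 * v p.2))
      (X * X) := by
    have hs : Summable (fun p : ℕ × ℕ =>
        ((chi3 (p.1 + 1) : ℂ) * chi3 (p.2 + 1)) * (v p.1 * v p.2)) := by
      apply summable_vv2 q hq
      intro p
      rw [norm_mul]
      exact mul_le_one₀ (norm_chi3_le _) (norm_nonneg _) (norm_chi3_le _)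
    have hs' : Summable (fun p : ℕ × ℕ =>
        ((chi3 (p.1 + 1) : ℂ) * v p.1) * ((chi3 (p.2 + 1) : ℂ) * v p.2)) := by
      refine hs.congr (fun p => ?_)
      ring
    have := hsx.hasSum.mul hsx.hasSum hs'
    refine hasSum_of_eq this (fun p => ?_)
    ring
  -- the part with differences
  have hA : Summable (fun p : ℕ × ℕ => cc ((p.1 - p.2) + (p.2 - p.1)) * (v p.1 * v p.2)) :=
    summable_vv2 q hq _ (fun p => norm_cc_le _)
  have hB : Summable (fun p : ℕ × ℕ => cc (p.1 + p.2 + 2) * (v p.1 * v p.2)) :=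
    summable_vv2 q hq _ (fun p => norm_cc_le _)
  obtain ⟨A, hA⟩ := hA
  obtain ⟨B, hB⟩ := hB
  have hAB : 3 * (X * X) = 2 * (A - B) := by
    have e1 := hXX.mul_left 3
    have e2 := (hA.sub hB).mul_left 2
    refine e1.unique ?_
    convert e2 using 1
    ext ⟨m, n⟩
    simp only
    rcases le_total m n with h | h
    · obtain ⟨k, rfl⟩ := Nat.exists_eq_add_of_le h
      have := chi_cc (m + 1) k
      rw [show m - (m + k) + (m + k - m) = k by omega,
        show m + (m + k) + 2 = 2 * (m + 1) + k by ring,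
        show m + k + 1 = m + 1 + k by ring]
      linear_combination (v m * v (m + k)) * this
    · obtain ⟨k, rfl⟩ := Nat.exists_eq_add_of_le h
      have := chi_cc (n + 1) k
      rw [show n + k - n + (n - (n + k)) = k by omega,
        show n + k + n + 2 = 2 * (n + 1) + k by ring,
        show n + k + 1 = n + 1 + k by ring]
      linear_combination (v n * v (n + k)) * this
  obtain ⟨s0, s1, s2, h0, h1, h2, hs⟩ := hasSum_split hA
  simp only at h0 h1 h2
  have h0' : HasSum (fun n => v n ^ 2) s0 := by
    convert h0 using 1
    ext n
    simp [cc]; ring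
  have h1' : HasSum (fun p : ℕ × ℕ => cc (p.2 + 1) * (v p.1 * v (p.1 + p.2 + 1))) s1 := by
    convert h1 using 1
    ext ⟨m, k⟩
    simp only
    rw [show m - (m + k + 1) + (m + k + 1 - m) = k + 1 by omega]
  have h21 : s2 = s1 := by
    refine h2.unique ?_
    convert h1' using 1
    ext ⟨m, k⟩
    simp only
    rw [show m + k + 1 - m + (m - (m + k + 1)) = k + 1 by omega]
    ring
  -- the two pieces of s1
  have hd2 : Summable (fun p : ℕ × ℕ => cc (p.2 + 1) * v (p.1 + p.2 + 1)) :=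
    summable_vv3 q hq _ (fun p => norm_cc_le _)
  obtain ⟨d2, hd2⟩ := hd2
  have hd1 : HasSum (fun p : ℕ × ℕ => cc (p.2 + 1) * (v p.2 * (v p.1 - v (p.1 + p.2 + 1))))
      (s1 + d2) := by
    convert h1'.add hd2 using 1
    ext ⟨m, k⟩
    have := vv_rel q hq m k
    simp only
    linear_combination cc (k + 1) * this
  have hsv : Summable v := by
    have := summable_vv q hq (fun _ => 1) (by simp)
    simpa using this
  have hd1' : HasSum (fun k => cc (k + 1) * (v k * ∑ j ∈ Finset.range (k + 1), v j))
      (s1 + d2) := by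
    have hsw := (Equiv.prodComm ℕ ℕ).hasSum_iff.2 hd1
    refine hsw.prod_fiberwise (fun k => ?_)
    simp only [Function.comp_apply, Equiv.prodComm_apply, Prod.fst_swap, Prod.snd_swap]
    apply HasSum.mul_left
    apply HasSum.mul_left
    have e1 := hsv.hasSum
    have e2 := ((summable_nat_add_iff (k + 1)).2 hsv).hasSum
    have e3 := hsv.sum_add_tsum_nat_add (k + 1)
    have e4 := e1.sub e2
    rw [← e3, add_sub_cancel_right] at e4
    exact e4
  have hd2' : HasSum (fun n => v n * ∑ k ∈ Finset.range n, cc (k + 1)) d2 := by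
    have e := hasSum_antidiagonal_of hd2
    rw [← hasSum_nat_add_iff' 1]
    simp only [Finset.range_one, Finset.sum_singleton, Finset.range_zero, Finset.sum_empty,
      mul_zero, sub_zero]
    refine hasSum_of_eq e (fun n => ?_)
    rw [Finset.mul_sum, ← Finset.Nat.sum_antidiagonal_swap,
      Finset.Nat.sum_antidiagonal_eq_sum_range_succ_mk]
    apply Finset.sum_congr rfl
    intro k hk
    have : k ≤ n := Nat.lt_succ_iff.1 (Finset.mem_range.1 hk)
    simp only [Prod.swap_prod_mk]
    rw [show n - k + k + 1 = n + 1 by omega]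
    ring
  have hB' : HasSum (fun n : ℕ => cc (n + 1) * (v n * (n + 2 * ∑ j ∈ Finset.range n, v j))) B := by
    have e := hasSum_antidiagonal_of hB
    rw [← hasSum_nat_add_iff' 1]
    simp only [Finset.range_one, Finset.sum_singleton, Finset.range_zero, Finset.sum_empty,
      mul_zero, sub_zero, Nat.cast_zero, add_zero]
    refine hasSum_of_eq e (fun n => ?_)
    have e1 : ∀ p ∈ Finset.HasAntidiagonal.antidiagonal n, cc (p.1 + p.2 + 2) * (v p.1 * v p.2) =
        cc (n + 1 + 1) * (v (n + 1) * (1 + v p.1 + v p.2)) := by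
      rintro ⟨i, j⟩ hp
      have hij : i + j = n := Finset.HasAntidiagonal.mem_antidiagonal.1 hp
      simp only
      rw [hij, vv_rel q hq i j, hij]
    rw [Finset.sum_congr rfl e1, ← Finset.mul_sum, ← Finset.mul_sum, Finset.sum_add_distrib,
      Finset.sum_add_distrib]
    have e2 : ∑ p ∈ Finset.HasAntidiagonal.antidiagonal n, v p.1 = ∑ j ∈ Finset.range (n + 1), v j :=
      Finset.Nat.sum_antidiagonal_eq_sum_range_succ_mk (fun p => v p.1) n
    have e3 : ∑ p ∈ Finset.HasAntidiagonal.antidiagonal n, v p.2 = ∑ j ∈ Finset.range (n + 1), v j := by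
      rw [← e2, ← Finset.Nat.sum_antidiagonal_swap]
      rfl
    rw [e2, e3]
    simp only [Finset.sum_const, Finset.Nat.card_antidiagonal, nsmul_eq_mul, mul_one]
    ring
  have hfin := (((hsx.hasSum.add (h0'.mul_left 2)).add (hd1'.mul_left 4)).sub
    (hd2'.mul_left 4)).sub (hB'.mul_left 2)
  have hval : X + 3 * X ^ 2 = X + 2 * s0 + 4 * (s1 + d2) - 4 * d2 - 2 * B := by
    rw [hs, h21] at hAB
    linear_combination hAB
  rw [hval]
  -- pointwise comparison
  refine hasSum_of_eq hfin (fun n => ?_)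
  rw [cc_sum, Finset.sum_range_succ]
  unfold cc chi3
  have h3 : n % 3 = 0 ∨ n % 3 = 1 ∨ n % 3 = 2 := by omega
  rcases h3 with h | h | h <;> simp [Nat.add_mod, h] <;> ring

lemma sum_mult_three (f : ℕ → ℂ) (a : ℂ) (hf : HasSum (fun n => f (3 * n + 2)) a) :
    HasSum (fun n => if (n + 1) % 3 = 0 then f n else 0) a := by
  have hi : Function.Injective (fun n : ℕ => 3 * n + 2) := by
    intro m n h
    simp only at h
    omega
  rw [← hi.hasSum_iff]
  · convert hf using 1
    ext n
    simp only [Function.comp_apply]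
    rw [if_pos (by omega)]
  · intro n hn
    rw [if_neg]
    intro h
    exact hn ⟨n / 3, by simp only; omega⟩

lemma summable_n_vv (q : ℂ) (hq : ‖q‖ < 1) : Summable (fun n : ℕ => ((n : ℂ) + 1) * vv q n) := by
  have h := summable_norm_pow_mul_geometric_div_one_sub 1 hq
  have h' := (summable_nat_add_iff 1).2 h
  refine h'.congr (fun n => ?_)
  unfold vv
  push_cast
  ring

lemma hasSum_sq (q : ℂ) (hq : ‖q‖ < 1) :
    HasSum (fun n => vv q n ^ 2 + vv q n) (∑' n : ℕ, ((n : ℂ) + 1) * vv q n) := by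
  -- the double series
  have hle : ∀ n : ℕ, ‖q ^ (n + 1)‖ < 1 := fun n => by
    rw [norm_pow]; exact pow_lt_one₀ (norm_nonneg q) hq (Nat.succ_ne_zero n)
  have hs : Summable (fun p : ℕ × ℕ => ((p.2 : ℂ) + 1) * (q ^ (p.1 + 1)) ^ (p.2 + 1)) := by
    have hg := summable_geometric_of_lt_one (norm_nonneg q) hq
    have hg2 : Summable (fun n : ℕ => ((n : ℝ) + 1) * ‖q‖ ^ n) := by
      have h1 := summable_pow_mul_geometric_of_norm_lt_one 1 (r := ‖q‖) (by simpa using hq)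
      refine (h1.add hg).congr (fun n => ?_)
      ring
    have := hg.mul_of_nonneg hg2 (fun n => by positivity) (fun n => by positivity)
    refine Summable.of_norm_bounded this (fun p => ?_)
    rw [norm_mul, ← pow_mul, norm_pow]
    have e1 : ‖((p.2 : ℂ) + 1)‖ = (p.2 : ℝ) + 1 := by
      have : ((p.2 : ℂ) + 1) = ((p.2 + 1 : ℕ) : ℂ) := by push_cast; ring
      rw [this, Complex.norm_natCast]; push_cast; ring
    have e2 : ‖q‖ ^ ((p.1 + 1) * (p.2 + 1)) ≤ ‖q‖ ^ (p.1 + p.2) :=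
      pow_le_pow_of_le_one (norm_nonneg q) hq.le (by nlinarith)
    rw [e1]
    calc _ ≤ ((p.2 : ℝ) + 1) * ‖q‖ ^ (p.1 + p.2) := by gcongr
      _ = _ := by rw [pow_add]; ring
  obtain ⟨a, ha⟩ := hs
  have h1 : HasSum (fun n => vv q n ^ 2 + vv q n) a := by
    refine ha.prod_fiberwise (fun n => ?_)
    have e := hasSum_coe_mul_geometric_of_norm_lt_one (hle n)
    rw [← hasSum_nat_add_iff' 1] at e
    simp only [Finset.range_one, Finset.sum_singleton, Nat.cast_zero, zero_mul, sub_zero,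
      Nat.cast_add, Nat.cast_one] at e
    have e1 : vv q n ^ 2 + vv q n = q ^ (n + 1) / (1 - q ^ (n + 1)) ^ 2 := by
      unfold vv
      have := one_sub_ne q hq n
      field_simp
      ring
    rw [e1]
    exact e
  have h2 : HasSum (fun n : ℕ => ((n : ℂ) + 1) * vv q n) a := by
    have hsw := (Equiv.prodComm ℕ ℕ).hasSum_iff.2 ha
    refine hsw.prod_fiberwise (fun n => ?_)
    simp only [Function.comp_apply, Equiv.prodComm_apply, Prod.fst_swap, Prod.snd_swap]
    apply HasSum.mul_left
    have e := (hasSum_geometric_of_norm_lt_one (hle n)).mul_left (q ^ (n + 1))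
    unfold vv
    rw [div_eq_mul_inv]
    convert e using 1
    ext k
    rw [← pow_mul, ← pow_mul, ← pow_add]
    congr 1
    ring
  rw [h2.tsum_eq]
  exact h1

lemma quad_identity (q : ℂ) (hq : ‖q‖ < 1) :
    (∑' n : ℕ, (chi3 (n + 1) : ℂ) * vv q n) + 3 * (∑' n : ℕ, (chi3 (n + 1) : ℂ) * vv q n) ^ 2 =
      (∑' n : ℕ, ((n : ℂ) + 1) * vv q n) - 3 * ∑' n : ℕ, ((n : ℂ) + 1) * vv (q ^ 3) n := by
  have hq3 : ‖q ^ 3‖ < 1 := by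
    rw [norm_pow]; exact pow_lt_one₀ (norm_nonneg q) hq (by norm_num)
  have hvv : ∀ n, vv q (3 * n + 2) = vv (q ^ 3) n := by
    intro n
    unfold vv
    rw [← pow_mul, show 3 * n + 2 + 1 = 3 * (n + 1) by ring]
  have h1 := (summable_n_vv q hq).hasSum
  have h2 := (hasSum_sq (q ^ 3) hq3).mul_left 6
  have h3 := (summable_n_vv (q ^ 3) hq3).hasSum.mul_left 9
  have h4 := sum_mult_three
    (fun n : ℕ => 6 * (vv q n ^ 2 + vv q n) - 3 * (((n : ℂ) + 1) * vv q n)) _ (by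
      refine hasSum_of_eq (h2.sub h3) (fun n => ?_)
      rw [hvv]
      push_cast
      ring)
  have := (key_hasSum q hq).unique (h1.add h4)
  rw [this]
  ring

end analysis

section theta

lemma fiber_divisors (q : ℂ) (c : ℕ) :
    ∑' b : (fun p : ℕ × ℕ => (p.1 + 1) * (p.2 + 1)) ⁻¹' {c},
      (chi3 (b.1.1 + 1) : ℂ) * q ^ ((b.1.1 + 1) * (b.1.2 + 1)) = (Lsum c : ℂ) * q ^ c := by
  let e : ((fun p : ℕ × ℕ => (p.1 + 1) * (p.2 + 1)) ⁻¹' {c} : Set (ℕ × ℕ)) ≃ c.divisors :=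
    { toFun := fun b => ⟨b.1.1 + 1, by
        have hb : (b.1.1 + 1) * (b.1.2 + 1) = c := b.2
        have hpos : 0 < (b.1.1 + 1) * (b.1.2 + 1) := by positivity
        rw [hb] at hpos
        exact Nat.mem_divisors.2 ⟨⟨_, hb.symm⟩, hpos.ne'⟩⟩
      invFun := fun d => ⟨(d.1 - 1, c / d.1 - 1), by
        have hd := Nat.mem_divisors.1 d.2
        have h1 : 0 < d.1 := Nat.pos_of_dvd_of_pos hd.1 (Nat.pos_of_ne_zero hd.2)
        have h2 : 0 < c / d.1 := Nat.div_pos (Nat.le_of_dvd (Nat.pos_of_ne_zero hd.2) hd.1) h1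
        change (d.1 - 1 + 1) * (c / d.1 - 1 + 1) = c
        rw [Nat.sub_add_cancel h1, Nat.sub_add_cancel h2, Nat.mul_div_cancel' hd.1]⟩
      left_inv := by
        rintro ⟨⟨a, b⟩, hb⟩
        have hb' : (a + 1) * (b + 1) = c := hb
        apply Subtype.ext
        simp only [← hb', Nat.add_sub_cancel, Nat.mul_div_cancel_left (b + 1) (Nat.succ_pos a)]
      right_inv := by
        rintro ⟨d, hd⟩
        apply Subtype.ext
        have hd := Nat.mem_divisors.1 hd
        have h1 : 0 < d := Nat.pos_of_dvd_of_pos hd.1 (Nat.pos_of_ne_zero hd.2)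
        simp only
        omega }
  have h1 : ∀ b : ((fun p : ℕ × ℕ => (p.1 + 1) * (p.2 + 1)) ⁻¹' {c} : Set (ℕ × ℕ)),
      (chi3 (b.1.1 + 1) : ℂ) * q ^ ((b.1.1 + 1) * (b.1.2 + 1)) =
        (fun d : c.divisors => (chi3 d.1 : ℂ) * q ^ c) (e b) := by
    intro b
    have hb : (b.1.1 + 1) * (b.1.2 + 1) = c := b.2
    rw [hb]
    rfl
  rw [tsum_congr h1, e.tsum_eq (fun d : c.divisors => (chi3 d.1 : ℂ) * q ^ c),
    Finset.tsum_subtype c.divisors (fun d => (chi3 d : ℂ) * q ^ c)]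
  unfold Lsum
  push_cast
  rw [Finset.sum_mul]

lemma lambert_hasSum (q : ℂ) (hq : ‖q‖ < 1) :
    HasSum (fun c : ℕ => (Lsum c : ℂ) * q ^ c) (∑' n : ℕ, (chi3 (n + 1) : ℂ) * vv q n) := by
  have hs : Summable (fun p : ℕ × ℕ => (chi3 (p.1 + 1) : ℂ) * q ^ ((p.1 + 1) * (p.2 + 1))) := by
    apply summable_of_geo2 ‖q‖ 1 (norm_nonneg q) hq
    intro p
    rw [norm_mul, norm_pow, ← pow_add]
    have e2 : ‖q‖ ^ ((p.1 + 1) * (p.2 + 1)) ≤ ‖q‖ ^ (p.1 + p.2) :=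
      pow_le_pow_of_le_one (norm_nonneg q) hq.le (by nlinarith)
    exact mul_le_mul (norm_chi3_le _) e2 (pow_nonneg (norm_nonneg q) _) zero_le_one
  obtain ⟨a, ha⟩ := hs
  have h1 := ha.tsum_fiberwise (fun p : ℕ × ℕ => (p.1 + 1) * (p.2 + 1))
  have h2 : HasSum (fun n : ℕ => (chi3 (n + 1) : ℂ) * vv q n) a := by
    refine ha.prod_fiberwise (fun n => ?_)
    have hle : ‖q ^ (n + 1)‖ < 1 := by
      rw [norm_pow]; exact pow_lt_one₀ (norm_nonneg q) hq (Nat.succ_ne_zero n)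
    have e := (hasSum_geometric_of_norm_lt_one hle).mul_left (q ^ (n + 1))
    have e1 : HasSum (fun k : ℕ => q ^ ((n + 1) * (k + 1))) (vv q n) := by
      unfold vv
      rw [div_eq_mul_inv]
      refine hasSum_of_eq e (fun k => ?_)
      rw [← pow_mul, ← pow_add]
      congr 1
      ring
    exact e1.mul_left _
  rw [h2.tsum_eq]
  refine hasSum_of_eq h1 (fun c => ?_)
  exact (fiber_divisors q c).symm

lemma form_nonneg (p : ℤ × ℤ) : 0 ≤ p.1 ^ 2 + p.1 * p.2 + p.2 ^ 2 := by
  nlinarith [sq_nonneg (p.1 + p.2), sq_nonneg p.1, sq_nonneg p.2]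

/-- The form, as a natural number. -/
def formN (p : ℤ × ℤ) : ℕ := (p.1 ^ 2 + p.1 * p.2 + p.2 ^ 2).toNat

lemma formN_cast (p : ℤ × ℤ) : (formN p : ℤ) = p.1 ^ 2 + p.1 * p.2 + p.2 ^ 2 :=
  Int.toNat_of_nonneg (form_nonneg p)

lemma formN_bound (p : ℤ × ℤ) : p.1.natAbs + p.2.natAbs ≤ 2 * formN p := by
  zify
  rw [formN_cast]
  have e1 : |p.1| ≤ p.1 ^ 2 := by rw [← sq_abs]; nlinarith [Int.le_self_sq |p.1|]
  have e2 : |p.2| ≤ p.2 ^ 2 := by rw [← sq_abs]; nlinarith [Int.le_self_sq |p.2|]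
  nlinarith [sq_nonneg (p.1 + p.2)]

lemma summable_natAbs (r : ℝ) (h0 : 0 ≤ r) (h1 : r < 1) :
    Summable (fun n : ℤ => r ^ n.natAbs) := by
  have hg := summable_geometric_of_lt_one h0 h1
  apply Summable.of_nat_of_neg
  · simpa using hg
  · simpa using hg

lemma summable_theta (q : ℂ) (hq : ‖q‖ < 1) : Summable (fun p : ℤ × ℤ => q ^ formN p) := by
  set r := Real.sqrt ‖q‖ with hr
  have h0 : 0 ≤ r := Real.sqrt_nonneg _
  have h1 : r < 1 := by
    rw [hr, Real.sqrt_lt' one_pos]; simpa using hq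
  have hrr : r ^ 2 = ‖q‖ := Real.sq_sqrt (norm_nonneg q)
  have hs := summable_natAbs r h0 h1
  have := hs.mul_of_nonneg hs (fun n => by positivity) (fun n => by positivity)
  refine Summable.of_norm_bounded this (fun p => ?_)
  rw [norm_pow, ← hrr, ← pow_mul, ← pow_add]
  exact pow_le_pow_of_le_one h0 h1.le (formN_bound p)

lemma a0_eq (q : ℂ) (hq : ‖q‖ < 1) :
    a0 q = 1 + 6 * ∑' n : ℕ, (chi3 (n + 1) : ℂ) * vv q n := by
  have ha : a0 q = ∑' p : ℤ × ℤ, q ^ formN p := by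
    unfold a0
    apply tsum_congr
    intro p
    rw [← formN_cast, zpow_natCast]
  have h1 := (summable_theta q hq).hasSum.tsum_fiberwise formN
  rw [← ha] at h1
  have hset : ∀ c : ℕ, formN ⁻¹' {c} = repSet c := by
    intro c
    ext p
    simp only [Set.mem_preimage, Set.mem_singleton_iff, repSet, Set.mem_ofPred_eq]
    rw [← formN_cast]
    norm_cast
  have h2 : HasSum (fun c : ℕ => ((repSet c).ncard : ℂ) * q ^ c) (a0 q) := by
    refine hasSum_of_eq h1 (fun c => ?_)
    have : ∀ b : (formN ⁻¹' {c} : Set (ℤ × ℤ)), q ^ formN b = q ^ c := by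
      intro b
      rw [show formN b = c from b.2]
    rw [tsum_congr this, tsum_const, nsmul_eq_mul, hset, Nat.card_coe_set_eq]
  have h3 := (lambert_hasSum q hq).mul_left 6
  have h4 : HasSum (fun c : ℕ => if c = 0 then (1 : ℂ) else 0) 1 := hasSum_ite_eq 0 1
  refine h2.unique (hasSum_of_eq (h4.add h3) (fun c => ?_))
  by_cases hc : c = 0
  · subst hc
    simp [repSet_zero, Lsum]
  · have := repSet_ncard c hc
    have h5 : ((repSet c).ncard : ℂ) = 6 * (Lsum c : ℂ) := by exact_mod_cast this
    rw [h5, if_neg hc]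
    ring

end theta

/-- `a₀(q)² = 1 + 12 ∑_{n≥1} n qⁿ/(1-qⁿ) - 36 ∑_{n≥1} n q^{3n}/(1-q^{3n})` for `|q| < 1`. -/
theorem stmt_1 (q : ℂ) (hq : ‖q‖ < 1) :
    (a0 q) ^ 2 =
      1 + 12 * ∑' n : ℕ, ((n : ℂ) + 1) * q ^ (n + 1) / (1 - q ^ (n + 1))
        - 36 * ∑' n : ℕ, ((n : ℂ) + 1) * q ^ (3 * (n + 1)) / (1 - q ^ (3 * (n + 1))) := by
  have h := quad_identity q hq
  have e1 : ∑' n : ℕ, ((n : ℂ) + 1) * q ^ (n + 1) / (1 - q ^ (n + 1)) =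
      ∑' n : ℕ, ((n : ℂ) + 1) * vv q n := by
    apply tsum_congr
    intro n
    unfold vv
    rw [mul_div_assoc]
  have e2 : ∑' n : ℕ, ((n : ℂ) + 1) * q ^ (3 * (n + 1)) / (1 - q ^ (3 * (n + 1))) =
      ∑' n : ℕ, ((n : ℂ) + 1) * vv (q ^ 3) n := by
    apply tsum_congr
    intro n
    unfold vv
    rw [mul_div_assoc, pow_mul]
  rw [e1, e2, a0_eq q hq]
  linear_combination 12 * h
end

section
/- Let a, b, c be nonnegative integers with a ≠ 0, c > 0 and b² - 4ac = -3. Then for every complex q with |q| < 1, ∑_{m,n ∈ ℤ} q^{a m² + b m n + c n²} = 1 + 6 ∑_{n=1}^∞ (n/3) qⁿ/(1-qⁿ), where (n/3) is the Legendre symbol mod 3. -/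
instance : Fact (Nat.Prime 3) := ⟨by norm_num⟩

/-- The principal form of discriminant -3. -/
def nrm (z : ℤ × ℤ) : ℤ := z.1 ^ 2 + z.1 * z.2 + z.2 ^ 2

def shearE (t : ℤ) : ℤ × ℤ ≃ ℤ × ℤ where
  toFun z := (z.1 + t * z.2, z.2)
  invFun z := (z.1 - t * z.2, z.2)
  left_inv z := by ext <;> simp
  right_inv z := by ext <;> simp

def shearF (t : ℤ) : ℤ × ℤ ≃ ℤ × ℤ where
  toFun z := (z.1, z.2 + t * z.1)
  invFun z := (z.1, z.2 - t * z.1)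
  left_inv z := by ext <;> simp
  right_inv z := by ext <;> simp

def flipE : ℤ × ℤ ≃ ℤ × ℤ where
  toFun z := (z.1, -z.2)
  invFun z := (z.1, -z.2)
  left_inv z := by ext <;> simp
  right_inv z := by ext <;> simp

theorem form_equiv (k : ℕ) : ∀ a b c : ℤ, 0 < a → 0 < c → b ^ 2 - 4 * a * c = -3 →
    a + c ≤ k → ∃ e : ℤ × ℤ ≃ ℤ × ℤ,
      ∀ z : ℤ × ℤ, a * z.1 ^ 2 + b * z.1 * z.2 + c * z.2 ^ 2 = nrm (e z) := by
  induction k with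
  | zero => intro a b c ha hc _ h; exfalso; push_cast at h; omega
  | succ k ih =>
    intro a b c ha hc hD hk
    push_cast at hk
    have stepC : ∀ s : ℤ, s ^ 2 = 1 → a < s * b → ∃ e : ℤ × ℤ ≃ ℤ × ℤ,
      ∀ z : ℤ × ℤ, a * z.1 ^ 2 + b * z.1 * z.2 + c * z.2 ^ 2 = nrm (e z) := by
      intro s hs hb
      have hc' : 0 < a - s * b + c := by
        have : 4 * a * (a - s * b + c) = (s * b - 2 * a) ^ 2 + 3 := by
          linear_combination -hD - b ^ 2 * hs
        by_contra hcon
        nlinarith [sq_nonneg (s * b - 2 * a)]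
      obtain ⟨e, he⟩ := ih a (b - 2 * s * a) (a - s * b + c) ha hc'
        (by linear_combination hD + 4 * a ^ 2 * hs) (by linarith)
      refine ⟨(shearE s).trans e, fun z => ?_⟩
      rw [Equiv.trans_apply, ← he]
      simp only [shearE, Equiv.coe_fn_mk]
      linear_combination (a * z.2 ^ 2) * hs
    have stepA : ∀ s : ℤ, s ^ 2 = 1 → c < s * b → ∃ e : ℤ × ℤ ≃ ℤ × ℤ,
      ∀ z : ℤ × ℤ, a * z.1 ^ 2 + b * z.1 * z.2 + c * z.2 ^ 2 = nrm (e z) := by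
      intro s hs hb
      have ha' : 0 < c - s * b + a := by
        have : 4 * c * (c - s * b + a) = (s * b - 2 * c) ^ 2 + 3 := by
          linear_combination -hD - b ^ 2 * hs
        by_contra hcon
        nlinarith [sq_nonneg (s * b - 2 * c)]
      obtain ⟨e, he⟩ := ih (c - s * b + a) (b - 2 * s * c) c ha' hc
        (by linear_combination hD + 4 * c ^ 2 * hs) (by linarith)
      refine ⟨(shearF s).trans e, fun z => ?_⟩
      rw [Equiv.trans_apply, ← he]
      simp only [shearF, Equiv.coe_fn_mk]
      linear_combination (c * z.1 ^ 2) * hs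
    by_cases h1 : a < b
    · exact stepC 1 (by norm_num) (by linarith)
    by_cases h2 : a < -b
    · exact stepC (-1) (by norm_num) (by linarith)
    by_cases h3 : c < b
    · exact stepA 1 (by norm_num) (by linarith)
    by_cases h4 : c < -b
    · exact stepA (-1) (by norm_num) (by linarith)
    have hb2 : b ^ 2 ≤ a * c := by
      rw [← sq_abs, pow_two]
      have : |b| ≤ a := abs_le.2 ⟨by linarith, by linarith⟩
      have : |b| ≤ c := abs_le.2 ⟨by linarith, by linarith⟩
      gcongr
    have hac : a * c ≤ 1 := by linarith
    have ha1 : a = 1 := by nlinarith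
    have hc1 : c = 1 := by nlinarith
    subst ha1 hc1
    have : b = 1 ∨ b = -1 := by
      have h0 : (b - 1) * (b + 1) = 0 := by linear_combination hD
      rcases mul_eq_zero.1 h0 with h | h
      · left; linarith
      · right; linarith
    rcases this with rfl | rfl
    · exact ⟨Equiv.refl _, fun z => by simp [nrm]⟩
    · exact ⟨flipE, fun z => by simp [nrm, flipE]⟩

theorem nrm_nonneg (z : ℤ × ℤ) : 0 ≤ nrm z := by
  unfold nrm; nlinarith [sq_nonneg (z.1 + z.2), sq_nonneg z.1, sq_nonneg z.2]

def rset (n : ℤ) : Set (ℤ × ℤ) := {z | nrm z = n}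

theorem rset_finite (n : ℤ) : (rset n).Finite := by
  refine ((Set.finite_Icc (-(2*n)) (2*n)).prod (Set.finite_Icc (-(2*n)) (2*n))).subset ?_
  rintro ⟨x, y⟩ h
  simp only [rset, nrm, Set.mem_ofPred_eq] at h
  have hx : x ^ 2 ≤ 2 * n := by nlinarith [sq_nonneg (x + y), sq_nonneg y]
  have hy : y ^ 2 ≤ 2 * n := by nlinarith [sq_nonneg (x + y), sq_nonneg x]
  simp only [Set.mem_prod, Set.mem_Icc]
  refine ⟨⟨?_, ?_⟩, ?_, ?_⟩ <;>
  nlinarith [Int.le_self_sq x, Int.le_self_sq (-x), Int.le_self_sq y, Int.le_self_sq (-y)]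

/-- multiplication by u + v ζ, with ζ² = ζ - 1 -/
def mulBy (w z : ℤ × ℤ) : ℤ × ℤ := (z.1 * w.1 - z.2 * w.2, z.1 * w.2 + z.2 * w.1 + z.2 * w.2)

theorem nrm_mulBy (w z : ℤ × ℤ) : nrm (mulBy w z) = nrm w * nrm z := by
  simp only [nrm, mulBy]; ring

theorem mulBy_inj (w : ℤ × ℤ) (hw : nrm w ≠ 0) : Function.Injective (mulBy w) := by
  rintro ⟨x, y⟩ ⟨x', y'⟩ h
  simp only [mulBy, Prod.mk.injEq] at h
  obtain ⟨h1, h2⟩ := h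
  simp only [nrm] at hw
  ext
  · apply mul_left_cancel₀ hw
    linear_combination (w.1 + w.2) * h1 + w.2 * h2
  · apply mul_left_cancel₀ hw
    linear_combination (w.1) * h2 - w.2 * h1

theorem ncard_mulBy (w : ℤ × ℤ) (hw : nrm w ≠ 0) (s : Set (ℤ × ℤ)) :
    (mulBy w '' s).ncard = s.ncard := Set.ncard_image_of_injective _ (mulBy_inj w hw)

theorem rset_three (m : ℤ) : rset (3 * m) = mulBy (1, 1) '' rset m := by
  ext ⟨x, y⟩
  simp only [rset, Set.mem_ofPred_eq, Set.mem_image]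
  constructor
  · intro h
    have h3 : (3:ℤ) ∣ (x - y) ^ 2 := ⟨m - x * y, by simp only [nrm] at h; linear_combination h⟩
    obtain ⟨t, ht⟩ := Int.prime_three.dvd_of_dvd_pow h3
    refine ⟨(y + 2 * t, -t), ?_, ?_⟩
    · have : x = y + 3 * t := by linarith
      subst this
      simp only [nrm] at h ⊢
      linarith
    · simp only [mulBy]; ext <;> simp <;> linarith
  · rintro ⟨w, hw, h⟩
    rw [← h, nrm_mulBy, hw]; simp [nrm]

/-- points whose p-multiple has norm p*m -/
def tset (p m : ℤ) : Set (ℤ × ℤ) := {z | p * nrm z = m}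

theorem mem_mulBy_p (p m : ℤ) (hp : p ≠ 0) (x y : ℤ) (h : nrm (x, y) = p * m) (hx : p ∣ x)
    (hy : p ∣ y) : (x, y) ∈ mulBy (p, 0) '' tset p m := by
  obtain ⟨s, rfl⟩ := hx
  obtain ⟨t, rfl⟩ := hy
  refine ⟨(s, t), ?_, ?_⟩
  · simp only [tset, Set.mem_ofPred_eq]
    apply mul_left_cancel₀ hp
    rw [← h]; simp only [nrm]; ring
  · simp only [mulBy]; ext <;> simp <;> ring

theorem of_mulBy_p (p m : ℤ) (z : ℤ × ℤ) (h : z ∈ mulBy (p, 0) '' tset p m) :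
    nrm z = p * m ∧ p ∣ z.1 ∧ p ∣ z.2 := by
  obtain ⟨w, hw, rfl⟩ := h
  rw [nrm_mulBy]
  simp only [tset, Set.mem_ofPred_eq] at hw
  refine ⟨?_, ?_, ?_⟩
  · rw [← hw]; simp [nrm]; ring
  · simp [mulBy]
  · simp [mulBy]

theorem inert_dvd (p : ℕ) [Fact p.Prime] (hp : p % 3 = 2) (x y : ℤ)
    (h : (p : ℤ) ∣ nrm (x, y)) : (p : ℤ) ∣ x ∧ (p : ℤ) ∣ y := by
  rw [← ZMod.intCast_zmod_eq_zero_iff_dvd, ← ZMod.intCast_zmod_eq_zero_iff_dvd]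
  rw [← ZMod.intCast_zmod_eq_zero_iff_dvd] at h
  simp only [nrm] at h
  push_cast at h
  generalize (x : ZMod p) = X at *
  generalize (y : ZMod p) = Y at *
  by_cases hY : Y = 0
  · subst hY; simpa using h
  have hX : X ≠ 0 := by
    rintro rfl; simp at h; exact hY h
  exfalso
  have hc : X ^ 3 = Y ^ 3 := by linear_combination (X - Y) * h
  have e1 := ZMod.pow_card_sub_one_eq_one hX
  have e2 := ZMod.pow_card_sub_one_eq_one hY
  obtain ⟨k, hk⟩ : ∃ k, p - 1 = 3 * k + 1 := ⟨p / 3, by omega⟩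
  rw [hk, pow_succ, pow_mul] at e1 e2
  rw [hc] at e1
  have hXY : X = Y := by
    apply mul_left_cancel₀ (pow_ne_zero k (pow_ne_zero 3 hY)); rw [e1, e2]
  subst hXY
  have h3 : (3 : ZMod p) * X ^ 2 = 0 := by linear_combination h
  have h3' : ((3 : ℕ) : ZMod p) = 0 := by
    rcases mul_eq_zero.1 h3 with h | h
    · exact_mod_cast h
    · exact absurd (pow_eq_zero_iff (by norm_num) |>.1 h) hX
  rw [ZMod.natCast_eq_zero_iff] at h3'
  have := (Nat.prime_dvd_prime_iff_eq Fact.out Nat.prime_three).1 h3'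
  omega

theorem rset_inert (p : ℕ) [hF : Fact p.Prime] (hp : p % 3 = 2) (m : ℤ) :
    rset (p * m) = mulBy (p, 0) '' tset p m := by
  have hp0 : (p : ℤ) ≠ 0 := by exact_mod_cast hF.out.ne_zero
  ext ⟨x, y⟩
  constructor
  · intro h
    obtain ⟨h1, h2⟩ := inert_dvd p hp x y ⟨m, h⟩
    exact mem_mulBy_p _ _ hp0 _ _ h h1 h2
  · intro h; exact (of_mulBy_p _ _ _ h).1

theorem split_rep (p : ℕ) [hF : Fact p.Prime] (hp : p % 3 = 1) : ∃ w, nrm w = p := by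
  obtain ⟨g, hg⟩ := exists_prime_orderOf_dvd_card (G := (ZMod p)ˣ) 3 (by
    rw [ZMod.card_units_eq_totient, Nat.totient_prime hF.out]; omega)
  have hg3 : g ^ 3 = 1 := by rw [← hg]; exact pow_orderOf_eq_one g
  have hg1 : g ≠ 1 := by rintro rfl; simp at hg
  have hG3 : (g : ZMod p) ^ 3 = 1 := by
    rw [← Units.val_pow_eq_pow_val, hg3, Units.val_one]
  have hG1 : (g : ZMod p) - 1 ≠ 0 := by
    intro h; apply hg1; ext; simpa using sub_eq_zero.1 h
  obtain ⟨h, hh⟩ := ZMod.intCast_surjective (g : ZMod p)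
  have hd : (p : ℤ) ∣ h ^ 2 + h + 1 := by
    rw [← ZMod.intCast_zmod_eq_zero_iff_dvd]; push_cast; rw [hh]
    apply mul_left_cancel₀ hG1; linear_combination hG3
  obtain ⟨k, hk⟩ := hd
  have hp0 : (0 : ℤ) < p := by exact_mod_cast hF.out.pos
  have hk0 : 0 < k := by
    by_contra hcon
    nlinarith [sq_nonneg (2 * h + 1)]
  obtain ⟨e, he⟩ := form_equiv (p + k).toNat p (2 * h + 1) k hp0 hk0
    (by linear_combination 4 * hk) (by rw [Int.toNat_of_nonneg]; omega)
  exact ⟨e (1, 0), by rw [← he]; simp⟩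

theorem rset_mem_of_dvd (p : ℕ) [hF : Fact p.Prime] (w z : ℤ × ℤ) (hw : nrm w = p) (m : ℤ)
    (h : nrm z = p * m) (hd : (p : ℤ) ∣ z.2 * w.1 - z.1 * w.2) : z ∈ mulBy w '' rset m := by
  have hp := Nat.prime_iff_prime_int.1 hF.out
  obtain ⟨x, y⟩ := z
  obtain ⟨u, v⟩ := w
  simp only [nrm] at *
  have hA : (p : ℤ) ∣ (x * u + x * v + y * v) ^ 2 := by
    have : (x * u + x * v + y * v) ^ 2 =
      p * (p * m) - (y * u - x * v) * ((x * u + x * v + y * v) + (y * u - x * v)) := by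
      rw [← h]; nth_rewrite 1 [← hw]; ring
    rw [this]
    exact dvd_sub (dvd_mul_right _ _) (hd.mul_right _)
  obtain ⟨s, hs⟩ := hp.dvd_of_dvd_pow hA
  obtain ⟨t, ht⟩ := hd
  have hz : mulBy (u, v) (s, t) = (x, y) := by
    simp only [mulBy]
    ext <;> apply mul_left_cancel₀ hp.ne_zero <;> simp only
    · linear_combination x * hw - u * hs + v * ht
    · linear_combination y * hw - v * hs - (u + v) * ht
  refine ⟨(s, t), ?_, hz⟩
  have := nrm_mulBy (u, v) (s, t)
  rw [hz] at this
  simp only [rset, Set.mem_ofPred_eq]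
  apply mul_left_cancel₀ hp.ne_zero
  simp only [nrm] at this ⊢
  rw [← h, this, hw]

theorem rset_split (p : ℕ) [hF : Fact p.Prime] (hp1 : p % 3 = 1) (m : ℤ) :
    (rset (p * m)).ncard + (tset p m).ncard = 2 * (rset m).ncard := by
  have hp := Nat.prime_iff_prime_int.1 hF.out
  obtain ⟨⟨u, v⟩, hw⟩ := split_rep p hp1
  have hw' : nrm (u + v, -v) = p := by rw [← hw]; simp only [nrm]; ring
  have hun : rset (p * m) = mulBy (u, v) '' rset m ∪ mulBy (u + v, -v) '' rset m := by
    ext z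
    constructor
    · intro h
      have h : nrm z = p * m := h
      have hd : (p : ℤ) ∣ (z.2 * u - z.1 * v) * (z.2 * (u + v) - z.1 * (-v)) := by
        refine ⟨z.2 ^ 2 - v ^ 2 * m, ?_⟩
        simp only [nrm] at h hw
        linear_combination z.2 ^ 2 * hw - v ^ 2 * h
      rcases hp.dvd_or_dvd hd with hd | hd
      · exact Or.inl (rset_mem_of_dvd p _ z hw m h hd)
      · exact Or.inr (rset_mem_of_dvd p _ z hw' m h hd)
    · rintro (⟨t, ht, rfl⟩ | ⟨t, ht, rfl⟩)
      · show nrm _ = _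
        rw [nrm_mulBy, hw, ht]
      · show nrm _ = _
        rw [nrm_mulBy, hw', ht]
  have hdvd_small : ∀ a : ℤ, (p : ℤ) ∣ a → a ^ 2 < p ^ 2 → a = 0 := by
    intro a ha hlt
    exact Int.eq_zero_of_abs_lt_dvd ha (by
      have := sq_lt_sq.1 hlt
      simpa using this)
  have hpp : 3 < (p : ℤ) := by
    have := hF.out.two_le
    omega
  have h3 : ¬ (p : ℤ) ∣ 3 := fun h => by have := Int.le_of_dvd (by norm_num) h; omega
  have h2 : ¬ (p : ℤ) ∣ 2 := fun h => by have := Int.le_of_dvd (by norm_num) h; omega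
  have hq : (2 * u + v) ^ 2 + 3 * v ^ 2 = 4 * p := by
    rw [← hw]; simp only [nrm]; ring
  have hv : ¬ (p : ℤ) ∣ v := by
    intro h
    have hv0 := hdvd_small v h (by nlinarith [sq_nonneg (2 * u + v)])
    subst hv0
    have : u ^ 2 = p := by rw [← hw]; simp [nrm]
    have hpu : (p : ℤ) ∣ u := hp.dvd_of_dvd_pow (n := 2) (by rw [this])
    have := hdvd_small u hpu (by nlinarith)
    subst this
    simp at *
    omega
  have huv : ¬ (p : ℤ) ∣ 2 * u + v := by
    intro h
    have : (p : ℤ) ∣ 3 * v ^ 2 := by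
      have e : 3 * v ^ 2 = 4 * p - (2 * u + v) * (2 * u + v) := by rw [← hq]; ring
      rw [e]; exact dvd_sub (dvd_mul_left _ _) (h.mul_right _)
    rcases hp.dvd_or_dvd this with h | h
    · exact h3 h
    · exact hv (hp.dvd_of_dvd_pow h)
  have hint : mulBy (u, v) '' rset m ∩ mulBy (u + v, -v) '' rset m = mulBy (p, 0) '' tset p m := by
    ext z
    constructor
    · rintro ⟨⟨⟨x, y⟩, h1, e1⟩, ⟨⟨x', y'⟩, h2', e2⟩⟩
      have hz : nrm z = p * m := by rw [← e1, nrm_mulBy, hw, h1]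
      obtain ⟨X, Y⟩ := z
      simp only [mulBy, Prod.mk.injEq] at e1 e2
      obtain ⟨e1, e1'⟩ := e1
      obtain ⟨e2, e2'⟩ := e2
      have d1 : Y * u - X * v = p * y := by
        rw [← hw, ← e1, ← e1']; simp only [nrm]; ring
      have d2 : Y * (u + v) + X * v = p * y' := by
        rw [← hw, ← e2, ← e2']; simp only [nrm]; ring
      have hY : (p : ℤ) ∣ Y := by
        have : (p : ℤ) ∣ Y * (2 * u + v) := ⟨y + y', by linear_combination d1 + d2⟩
        exact (hp.dvd_or_dvd this).resolve_right huv
      have hX : (p : ℤ) ∣ X := by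
        have : (p : ℤ) ∣ X * v := by
          have e : X * v = Y * u - p * y := by linear_combination -d1
          rw [e]; exact dvd_sub (hY.mul_right _) (dvd_mul_right _ _)
        exact (hp.dvd_or_dvd this).resolve_right hv
      exact mem_mulBy_p _ _ hp.ne_zero _ _ hz hX hY
    · intro h
      obtain ⟨h1, h2, h3⟩ := of_mulBy_p _ _ _ h
      exact ⟨rset_mem_of_dvd p _ z hw m h1 (dvd_sub (h3.mul_right _) (h2.mul_right _)),
        rset_mem_of_dvd p _ z hw' m h1 (dvd_sub (h3.mul_right _) (h2.mul_right _))⟩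
  have hfin := rset_finite m
  have := Set.ncard_union_add_ncard_inter (mulBy (u, v) '' rset m) (mulBy (u + v, -v) '' rset m)
    (hfin.image _) (hfin.image _)
  rw [← hun, hint, ncard_mulBy _ (by simp [nrm]; exact hF.out.ne_zero),
    ncard_mulBy _ (by rw [hw]; exact hp.ne_zero), ncard_mulBy _ (by rw [hw']; exact hp.ne_zero)] at this
  omega

theorem tset_ncard (p : ℕ) (hp : p ≠ 0) (m : ℕ) :
    (tset p m).ncard = if p ∣ m then (rset ((m / p : ℕ) : ℤ)).ncard else 0 := by
  split_ifs with h
  · obtain ⟨k, rfl⟩ := h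
    rw [Nat.mul_div_cancel_left _ (Nat.pos_of_ne_zero hp)]
    congr 1
    ext z
    simp only [tset, rset, Set.mem_ofPred_eq]
    push_cast
    have : (p : ℤ) ≠ 0 := by exact_mod_cast hp
    exact mul_right_inj' this
  · have : tset p m = ∅ := by
      ext z
      simp only [tset, Set.mem_ofPred_eq, Set.mem_empty_iff_false, iff_false]
      intro hz
      exact h (by exact_mod_cast (Dvd.intro _ hz : (p : ℤ) ∣ m))
    rw [this, Set.ncard_empty]

theorem leg_eq (n : ℕ) : legendreSym 3 (n : ℤ) = if n % 3 = 0 then 0 else if n % 3 = 1 then 1 else -1 := by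
  rw [legendreSym.mod]
  have : (n : ℤ) % (3 : ℕ) = ((n % 3 : ℕ) : ℤ) := by simp
  rw [this]
  have h := Nat.mod_lt n (show 0 < 3 by norm_num)
  interval_cases n % 3 <;> decide

theorem rset_rec (p : ℕ) (hpr : p.Prime) (m : ℕ) :
    ((rset ((p * m : ℕ) : ℤ)).ncard : ℤ) = (1 + legendreSym 3 p) * (rset m).ncard
      - legendreSym 3 p * (if p ∣ m then (rset ((m / p : ℕ) : ℤ)).ncard else 0 : ℕ) := by
  have := Fact.mk hpr
  rw [← tset_ncard p hpr.ne_zero, leg_eq]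
  push_cast
  have hlt := Nat.mod_lt p (show 0 < 3 by norm_num)
  rcases (by omega : p % 3 = 0 ∨ p % 3 = 1 ∨ p % 3 = 2) with h | h | h
  · have : p = 3 := ((Nat.prime_dvd_prime_iff_eq Nat.prime_three hpr).1 (Nat.dvd_of_mod_eq_zero h)).symm
    subst this
    have e := rset_three m
    have e2 := ncard_mulBy (1, 1) (by simp [nrm]) (rset m)
    rw [← e] at e2
    simpa using e2
  · have := rset_split p h m
    simp only [h]
    norm_num
    linarith
  · have := rset_inert p h m
    rw [this, ncard_mulBy _ (by simp [nrm]; exact hpr.ne_zero)]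
    simp [h]

/-- The divisor sum of the character. -/
def fsum (n : ℕ) : ℤ := ∑ d ∈ n.divisors, legendreSym 3 d

theorem fsum_rec (p : ℕ) (hpr : p.Prime) (m : ℕ) (hm : m ≠ 0) :
    fsum (p * m) = (1 + legendreSym 3 p) * fsum m
      - legendreSym 3 p * (if p ∣ m then fsum (m / p) else 0) := by
  have himg : ∀ k : ℕ, ∑ d ∈ k.divisors.image (fun d => p * d), legendreSym 3 (d : ℤ)
      = legendreSym 3 p * fsum k := by
    intro k
    rw [Finset.sum_image (fun a _ b _ h => Nat.eq_of_mul_eq_mul_left hpr.pos h), fsum,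
      Finset.mul_sum]
    refine Finset.sum_congr rfl fun d _ => ?_
    push_cast
    exact legendreSym.mul 3 _ _
  have hun : (p * m).divisors = m.divisors ∪ m.divisors.image (fun d => p * d) := by
    ext d
    simp only [Nat.mem_divisors, Finset.mem_union, Finset.mem_image]
    constructor
    · rintro ⟨h, h0⟩
      by_cases hd : p ∣ d
      · obtain ⟨e, rfl⟩ := hd
        exact Or.inr ⟨e, ⟨Nat.dvd_of_mul_dvd_mul_left hpr.pos h, hm⟩, rfl⟩
      · exact Or.inl ⟨(Nat.Coprime.dvd_of_dvd_mul_left ((Nat.Prime.coprime_iff_not_dvd hpr).2 hd).symm h), hm⟩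
    · rintro (⟨h, -⟩ | ⟨e, ⟨h, -⟩, rfl⟩)
      · exact ⟨h.mul_left _, mul_ne_zero hpr.ne_zero hm⟩
      · exact ⟨Nat.mul_dvd_mul_left _ h, mul_ne_zero hpr.ne_zero hm⟩
  have hin : ∑ d ∈ m.divisors ∩ m.divisors.image (fun d => p * d), legendreSym 3 (d : ℤ)
      = legendreSym 3 p * (if p ∣ m then fsum (m / p) else 0) := by
    split_ifs with h
    · obtain ⟨k, rfl⟩ := h
      rw [Nat.mul_div_cancel_left _ hpr.pos, ← himg]
      refine Finset.sum_congr ?_ fun _ _ => rfl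
      have hk : k ≠ 0 := right_ne_zero_of_mul hm
      ext d
      simp only [Nat.mem_divisors, Finset.mem_inter, Finset.mem_image]
      constructor
      · rintro ⟨⟨h1, -⟩, e, ⟨h2, -⟩, rfl⟩
        exact ⟨e, ⟨Nat.dvd_of_mul_dvd_mul_left hpr.pos h1, hk⟩, rfl⟩
      · rintro ⟨e, ⟨h, -⟩, rfl⟩
        exact ⟨⟨Nat.mul_dvd_mul_left _ h, hm⟩, e, ⟨h.mul_left _, hm⟩, rfl⟩
    · rw [mul_zero]
      apply Finset.sum_eq_zero
      intro d hd
      simp only [Nat.mem_divisors, Finset.mem_inter, Finset.mem_image] at hd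
      obtain ⟨⟨h1, -⟩, e, ⟨h2, -⟩, rfl⟩ := hd
      exact absurd (dvd_of_mul_right_dvd h1) h
  have := Finset.sum_union_inter (s₁ := m.divisors) (s₂ := m.divisors.image (fun d => p * d))
    (f := fun d : ℕ => legendreSym 3 (d : ℤ))
  rw [← hun, hin, himg] at this
  simp only [fsum] at *
  linarith

theorem rset_one : (rset 1).ncard = 6 := by
  have : rset 1 = (({(1,0), (-1,0), (0,1), (0,-1), (1,-1), (-1,1)} : Finset (ℤ × ℤ)) : Set (ℤ × ℤ)) := by
    ext ⟨x, y⟩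
    simp only [rset, nrm, Set.mem_ofPred_eq]
    constructor
    · intro h
      have hx : x ≤ 1 := by nlinarith [sq_nonneg (x + 2 * y)]
      have hx' : -1 ≤ x := by nlinarith [sq_nonneg (x + 2 * y)]
      have hy : y ≤ 1 := by nlinarith [sq_nonneg (2 * x + y)]
      have hy' : -1 ≤ y := by nlinarith [sq_nonneg (2 * x + y)]
      interval_cases x <;> interval_cases y <;> simp_all
    · intro h
      simp at h
      rcases h with h | h | h | h | h | h <;> obtain ⟨rfl, rfl⟩ := h <;> norm_num
  rw [this, Set.ncard_coe_finset]
  decide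

theorem rset_ncard (n : ℕ) (hn : n ≠ 0) : ((rset n).ncard : ℤ) = 6 * fsum n := by
  induction n using Nat.strong_induction_on with
  | _ n ih =>
    by_cases h1 : n = 1
    · subst h1
      have := rset_one
      simp [this, fsum]
    · obtain ⟨p, hpr, m, rfl⟩ := Nat.exists_prime_and_dvd h1
      have hm : m ≠ 0 := right_ne_zero_of_mul hn
      have hlt : m < p * m := by nlinarith [hpr.two_le, Nat.pos_of_ne_zero hm]
      rw [rset_rec p hpr m, fsum_rec p hpr m hm, ih m hlt hm]
      split_ifs with hd
      · have hle := Nat.div_le_self m p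
        rw [ih (m / p) (by omega) (Nat.div_ne_zero_iff.2 ⟨hpr.ne_zero, Nat.le_of_dvd (Nat.pos_of_ne_zero hm) hd⟩)]
        ring
      · simp; ring


theorem lambert (q : ℂ) (hq : ‖q‖ < 1) :
    HasSum (fun n : ℕ+ => (fsum n : ℂ) * q ^ (n : ℕ))
      (∑' n : ℕ, (legendreSym 3 ((n : ℤ) + 1) : ℂ) * q ^ (n + 1) / (1 - q ^ (n + 1))) := by
  have hle : ∀ n : ℕ, ‖(legendreSym 3 (n : ℤ) : ℂ)‖ ≤ 1 := by
    intro n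
    rw [leg_eq]
    split_ifs <;> simp
  let F : ℕ+ × ℕ+ → ℂ := fun c => (legendreSym 3 (c.1 : ℕ) : ℂ) * q ^ (c.1 * c.2 : ℕ)
  have hF : Summable F := by
    refine Summable.of_norm_bounded (summable_prod_mul_pow 0 hq).norm fun c => ?_
    simp only [F, norm_mul, pow_zero, one_mul]
    exact mul_le_of_le_one_left (norm_nonneg _) (hle _)
  have hval : ∑' c, F c =
      ∑' n : ℕ, (legendreSym 3 ((n : ℤ) + 1) : ℂ) * q ^ (n + 1) / (1 - q ^ (n + 1)) := by
    rw [hF.tsum_prod]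
    rw [← tsum_pnat_eq_tsum_succ (f := fun n : ℕ => (legendreSym 3 (n : ℤ) : ℂ) * q ^ n / (1 - q ^ n)) |>.trans (tsum_congr fun n => by push_cast; rfl)]
    refine tsum_congr fun n => ?_
    have hn : ‖q ^ (n : ℕ)‖ < 1 := by
      rw [norm_pow]; exact pow_lt_one₀ (norm_nonneg _) hq n.ne_zero
    simp only [F]
    rw [tsum_mul_left, mul_div_assoc]
    congr 1
    rw [tsum_pnat_eq_tsum_succ (f := fun k : ℕ => q ^ ((n : ℕ) * k))]
    simp only [mul_add, pow_add, mul_one, pow_mul]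
    rw [tsum_mul_right, tsum_geometric_of_norm_lt_one hn, div_eq_mul_inv, mul_comm]
  rw [← hval]
  have h1 := (sigmaAntidiagonalEquivProd.hasSum_iff).2 hF.hasSum
  refine h1.sigma fun n => ?_
  have h2 := hasSum_fintype (fun c : {x // x ∈ Nat.divisorsAntidiagonal (n : ℕ)} =>
    (F ∘ sigmaAntidiagonalEquivProd) ⟨n, c⟩)
  convert h2 using 1
  have h3 : ∀ c : {x // x ∈ Nat.divisorsAntidiagonal (n : ℕ)},
      (F ∘ sigmaAntidiagonalEquivProd) ⟨n, c⟩ = (legendreSym 3 (c.1.1 : ℕ) : ℂ) * q ^ (n : ℕ) := by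
    rintro ⟨⟨x, y⟩, hc⟩
    have := (Nat.mem_divisorsAntidiagonal.1 hc).1
    simp only [F, Function.comp, sigmaAntidiagonalEquivProd, divisorsAntidiagonalFactors,
      Equiv.coe_fn_mk, PNat.mk_coe]
    simp only at this
    rw [this]
  rw [Finset.sum_congr rfl fun c _ => h3 c, ← Finset.sum_mul, Finset.univ_eq_attach,
    Finset.sum_attach _ (fun c : ℕ × ℕ => (legendreSym 3 (c.1 : ℕ) : ℂ)),
    Nat.sum_divisorsAntidiagonal (fun x _ => (legendreSym 3 (x : ℕ) : ℂ)), fsum]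
  push_cast
  rfl

theorem fsum_le (n : ℕ) : fsum n ≤ n := by
  have : fsum n ≤ ∑ d ∈ n.divisors, 1 := by
    refine Finset.sum_le_sum fun d _ => ?_
    rw [leg_eq]; split_ifs <;> norm_num
  refine this.trans ?_
  simpa using Nat.card_divisors_le_self n

theorem rset_zero : (rset 0).ncard = 1 := by
  rw [Set.ncard_eq_one]
  refine ⟨(0, 0), ?_⟩
  ext ⟨x, y⟩
  simp only [rset, nrm, Set.mem_ofPred_eq, Set.mem_singleton_iff, Prod.mk.injEq]
  constructor
  · intro h
    have hx : x ^ 2 = 0 := by nlinarith [sq_nonneg (x + 2 * y), sq_nonneg x]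
    have hy : y ^ 2 = 0 := by nlinarith [sq_nonneg (y + 2 * x), sq_nonneg y]
    exact ⟨by simpa using hx, by simpa using hy⟩
  · rintro ⟨rfl, rfl⟩; norm_num

theorem theta_hasSum (q : ℂ) (hq : ‖q‖ < 1) :
    HasSum (fun n : ℕ => ((rset n).ncard : ℂ) * q ^ n) (∑' z : ℤ × ℤ, q ^ nrm z) := by
  let φ : ℤ × ℤ → ℕ := fun z => (nrm z).toNat
  let e := Equiv.sigmaFiberEquiv φ
  have hφ : ∀ z, (φ z : ℤ) = nrm z := fun z => Int.toNat_of_nonneg (nrm_nonneg z)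
  have hset : ∀ n : ℕ, {z | φ z = n} = rset n := by
    intro n; ext z
    simp only [Set.mem_ofPred_eq, rset, ← hφ]
    norm_cast
  have hfin : ∀ n : ℕ, Finite {z // φ z = n} := fun n => by
    have := rset_finite n
    rw [← hset] at this
    exact this
  have hcard : ∀ n : ℕ, Nat.card {z // φ z = n} = (rset n).ncard := fun n => by
    rw [← hset]; rfl
  have hfib : ∀ (n : ℕ) (y : {z // φ z = n}), q ^ nrm (e ⟨n, y⟩) = q ^ n := by
    rintro n ⟨z, hz⟩
    have : e ⟨n, ⟨z, hz⟩⟩ = z := rfl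
    rw [this, ← hφ, hz, zpow_natCast]
  have hsum : Summable fun s : (Σ n, {z // φ z = n}) => q ^ nrm (e s) := by
    apply Summable.of_norm
    rw [summable_sigma_of_nonneg (fun _ => norm_nonneg _)]
    refine ⟨fun n => Summable.of_finite, ?_⟩
    have hb : ∀ n : ℕ, ∑' y : {z // φ z = n}, ‖q ^ nrm (e ⟨n, y⟩)‖ = (rset n).ncard * ‖q‖ ^ n := by
      intro n
      simp only [hfib, tsum_const, hcard, norm_pow, nsmul_eq_mul]
    simp only [hb]
    have hq' : ‖(‖q‖ : ℝ)‖ < 1 := by simpa using hq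
    have s1 := (summable_pow_mul_geometric_of_norm_lt_one 1 hq').mul_left 6
    have s2 := summable_geometric_of_norm_lt_one hq'
    refine Summable.of_nonneg_of_le (fun n => by positivity) (fun n => ?_) (s1.add s2)
    have : ((rset n).ncard : ℝ) ≤ 6 * n + 1 := by
      rcases eq_or_ne n 0 with rfl | hn
      · simp [rset_zero]
      · have h1 := rset_ncard n hn
        have h2 := fsum_le n
        have h3 : ((rset n).ncard : ℤ) ≤ 6 * n + 1 := by linarith
        exact_mod_cast h3
    have hp : 0 ≤ ‖q‖ ^ n := by positivity
    nlinarith [mul_le_mul_of_nonneg_right this hp]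
  have h1 := hsum.hasSum
  rw [e.tsum_eq (fun z => q ^ nrm z)] at h1
  refine h1.sigma fun n => ?_
  have := Fintype.ofFinite {z // φ z = n}
  have h2 := hasSum_fintype (fun y : {z // φ z = n} => q ^ nrm (e ⟨n, y⟩))
  convert h2 using 1
  simp only [hfib, Finset.sum_const, Finset.card_univ, nsmul_eq_mul, ← hcard,
    Nat.card_eq_fintype_card]

/-- For a form `ax²+bxy+cy²` of discriminant `-3` (nonnegative coefficients, `a ≠ 0`,
`c > 0`), the theta series equals `1 + 6 ∑_{n≥1} (n/3) qⁿ/(1-qⁿ)` for `|q| < 1`,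
where `(·/3)` is the Legendre symbol mod 3. -/
theorem stmt_12 (a b c : ℕ) (ha : a ≠ 0) (hc : 0 < c)
    (hD : (b : ℤ) ^ 2 - 4 * a * c = -3)
    (q : ℂ) (hq : ‖q‖ < 1) :
    ∑' p : ℤ × ℤ, q ^ ((a : ℤ) * p.1 ^ 2 + (b : ℤ) * p.1 * p.2 + (c : ℤ) * p.2 ^ 2) =
      1 + 6 * ∑' n : ℕ,
        (legendreSym 3 ((n : ℤ) + 1) : ℂ) * q ^ (n + 1) / (1 - q ^ (n + 1)) := by
  have hn0 : (0 : ℤ) < a := by exact_mod_cast Nat.pos_of_ne_zero ha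
  obtain ⟨e, he⟩ := form_equiv (a + c) a b c hn0 (by exact_mod_cast hc) hD (by push_cast; rfl)
  simp only [he]
  rw [e.tsum_eq (fun z => q ^ nrm z)]
  have h1 := theta_hasSum q hq
  have h2 := (lambert q hq).mul_left 6
  rw [← h1.tsum_eq, h1.summable.tsum_eq_zero_add, ← (lambert q hq).tsum_eq, ← tsum_mul_left,
    tsum_pnat_eq_tsum_succ (f := fun n : ℕ => 6 * ((fsum n : ℂ) * q ^ n))]
  congr 1
  · simp [rset_zero]
  · refine tsum_congr fun n => ?_
    have h := rset_ncard (n + 1) (by omega)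
    have h' : ((rset ((n + 1 : ℕ) : ℤ)).ncard : ℂ) = 6 * (fsum (n + 1) : ℂ) := by exact_mod_cast h
    rw [h', mul_assoc]
end
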